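/- arXiv:2112.12111 — 3 statements merged into one kernel-verified Lean document; each statement's English description precedes it below -/
import Mathlib

section
/- Let A be the companion matrix of f(x) = (x−1)⁶ and B the companion matrix of the seventh cyclotomic polynomial g(x) = x⁶+x⁵+x⁴+x³+x²+x+1, regarded as elements of GL₆(ℚ), and set T = B·A⁻¹. Then B⁷ = I, B ≠ I, T has infinite order, and the group homomorphism from the free product ℤ ∗ (ℤ/7ℤ) to GL₆(ℚ) sending the generator 1 of ℤ to T and the generator 1 of ℤ/7ℤ to B is injective; in particular the group ⟨A,B⟩ is isomorphic to ℤ ∗ ℤ/7ℤ. (This is the hypergeometric monodromy group of case A-37, the septic member of the Dwork family, with α = (0,0,0,0,0,0) and β = (1/7,2/7,3/7,4/7,5/7,6/7).) -/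
open Matrix Polynomial

/-- The companion matrix of a (monic degree `n`) polynomial `p`:
the `n × n` matrix with subdiagonal entries `1`, last column
`(-c₀, …, -c_{n-1})ᵀ`, and `0` elsewhere. -/
def companionMatrix {K : Type*} [CommRing K] (n : ℕ) (p : Polynomial K) :
    Matrix (Fin n) (Fin n) K :=
  Matrix.of fun i j =>
    if (j : ℕ) + 1 = n then -p.coeff i
    else if (i : ℕ) = (j : ℕ) + 1 then 1 else 0

namespace DworkSeptic

/-- The cyclic shift `i ↦ i + k` of the coordinates. -/
def rot (k : Fin 7) (s : Fin 7 → ℚ) : Fin 7 → ℚ := fun i => s (i - k)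

/-- The reversal of the coordinates; it conjugates `rot k` to `rot (-k)` and `transv`
to its inverse. -/
def refl (s : Fin 7 → ℚ) : Fin 7 → ℚ := fun i => s (-i)

/-- The direction of the transvection. -/
def dir : Fin 7 → ℚ := ![0, 7, -21, 35, -35, 21, -7]

/-- The powers of the transvection `s ↦ s + s 0 • dir`. -/
def transv (n : ℚ) (s : Fin 7 → ℚ) : Fin 7 → ℚ := fun i => s i + n * s 0 * dir i

/-- An open polyhedral cone in the hyperplane `∑ i, s i = 0`. -/
def InCone (s : Fin 7 → ℚ) : Prop :=
  s 0 = -(s 1 + s 2 + s 3 + s 4 + s 5 + s 6) ∧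
  0 < -(s 1 + s 2 + s 3 + s 4 + s 5 + s 6) ∧
  0 < 157 * s 1 + 145 * s 2 + 148 * s 3 + 146 * s 4 + 149 * s 5 + 137 * s 6 ∧
  0 < -45 * s 1 - 55 * s 2 - 54 * s 3 - 54 * s 4 - 55 * s 5 - 45 * s 6 ∧
  0 < 32 * s 1 + 25 * s 2 + 24 * s 3 + 25 * s 4 + 24 * s 5 + 17 * s 6 ∧
  0 < -3 * s 1 - 5 * s 2 - 6 * s 3 - 6 * s 4 - 5 * s 5 - 3 * s 6 ∧
  0 < 6 * s 1 + 5 * s 2 + 4 * s 3 + 3 * s 4 + 2 * s 5 + s 6 ∧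
  0 < -12 * s 1 - 9 * s 2 - 11 * s 3 - 8 * s 4 - 20 * s 5 - 157 * s 6 ∧
  0 < 10 * s 1 + 9 * s 2 + 9 * s 3 + 10 * s 4 - 45 * s 6 ∧
  0 < s 1 + s 2 + 10 * s 4 + 55 * s 5 + 10 * s 6 ∧
  0 < -10 * s 1 - 55 * s 2 - 10 * s 3 - s 5 - s 6 ∧
  0 < s 2 - 9 * s 3 - 54 * s 4 - 9 * s 5 + s 6 ∧
  0 < -s 1 + 9 * s 2 + 54 * s 3 + 9 * s 4 - s 5 ∧
  0 < -s 1 - s 3 - 8 * s 4 + 24 * s 5 + 7 * s 6 ∧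
  0 < -s 1 + 7 * s 3 - 25 * s 4 - 8 * s 5 - s 6 ∧
  0 < s 1 + 8 * s 2 + 25 * s 3 - 7 * s 4 + s 6 ∧
  0 < s 1 - 7 * s 3 - 24 * s 4 + 8 * s 5 + s 6 ∧
  0 < -7 * s 1 - 8 * s 2 - 7 * s 3 - 8 * s 4 - 15 * s 5 - 32 * s 6 ∧
  0 < 2 * s 1 + 3 * s 2 + 3 * s 3 + 2 * s 4 - 3 * s 6 ∧
  0 < -s 1 - s 2 + 2 * s 4 + 5 * s 5 + 2 * s 6 ∧
  0 < -2 * s 1 - 5 * s 2 - 2 * s 3 + s 5 + s 6 ∧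
  0 < -s 2 - 3 * s 3 - 6 * s 4 - 3 * s 5 - s 6 ∧
  0 < s 1 + 3 * s 2 + 6 * s 3 + 3 * s 4 + s 5 ∧
  0 < 2 * s 1 + 5 * s 2 + 2 * s 3 - s 5 - 71 * s 6 ∧
  0 < -s 1 - 3 * s 2 - 6 * s 3 - 3 * s 4 - s 5 - 70 * s 6

theorem InCone.signs {s : Fin 7 → ℚ} (h : InCone s) :
    0 < s 0 ∧ s 0 < s 1 ∧ s 2 < 0 ∧ 0 < s 3 ∧ s 4 < 0 ∧ 0 < s 5 ∧ s 6 < 0 := by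
  obtain ⟨h0, h1, h2, h3, h4, h5, h6, h7, h8, h9, h10, h11, h12, h13, h14, h15, h16, h17, h18,
    h19, h20, h21, h22, h23, h24⟩ := h
  refine ⟨?_, ?_, ?_, ?_, ?_, ?_, ?_⟩ <;> linarith

theorem InCone.transv_one {s : Fin 7 → ℚ} (h : InCone s) : InCone (transv 1 s) := by
  obtain ⟨h0, h1, h2, h3, h4, h5, h6, h7, h8, h9, h10, h11, h12, h13, h14, h15, h16, h17, h18,
    h19, h20, h21, h22, h23, h24⟩ := h
  simp only [InCone, transv, dir, h0]
  simp
  refine ⟨?_, ?_, ?_, ?_, ?_, ?_, ?_, ?_, ?_, ?_, ?_, ?_, ?_, ?_, ?_, ?_, ?_, ?_, ?_, ?_, ?_, ?_,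
    ?_, ?_, ?_⟩ <;> linarith

theorem fin_seven_cases {k : Fin 7} (hk : k ≠ 0) :
    k = 1 ∨ k = 2 ∨ k = 3 ∨ k = 4 ∨ k = 5 ∨ k = 6 := by
  decide +revert

theorem fin_seven_neg : (-1 : Fin 7) = 6 ∧ (-2 : Fin 7) = 5 ∧ (-3 : Fin 7) = 4 ∧
    (-4 : Fin 7) = 3 ∧ (-5 : Fin 7) = 2 ∧ (-6 : Fin 7) = 1 := by
  decide

theorem InCone.transv_rot {s : Fin 7 → ℚ} (h : InCone s) {k : Fin 7} (hk : k ≠ 0) :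
    InCone (transv 1 (rot k s)) ∨ InCone (-transv 1 (rot k s)) := by
  obtain ⟨h0, h1, h2, h3, h4, h5, h6, h7, h8, h9, h10, h11, h12, h13, h14, h15, h16, h17, h18,
    h19, h20, h21, h22, h23, h24⟩ := h
  obtain rfl | rfl | rfl | rfl | rfl | rfl := fin_seven_cases hk
  on_goal 1 => right
  on_goal 2 => left
  on_goal 3 => right
  on_goal 4 => left
  on_goal 5 => right
  on_goal 6 => left
  all_goals
    simp [InCone, transv, rot, dir, h0, fin_seven_neg]
    refine ⟨?_, ?_, ?_, ?_, ?_, ?_, ?_, ?_, ?_, ?_, ?_, ?_, ?_, ?_, ?_, ?_, ?_, ?_, ?_, ?_, ?_, ?_,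
      ?_, ?_, ?_⟩ <;> linarith

theorem InCone.transv_rot_refl {s : Fin 7 → ℚ} (h : InCone s) {k : Fin 7} (hk : k ≠ 0) :
    InCone (transv 1 (rot k (refl s))) ∨ InCone (-transv 1 (rot k (refl s))) := by
  obtain ⟨h0, h1, h2, h3, h4, h5, h6, h7, h8, h9, h10, h11, h12, h13, h14, h15, h16, h17, h18,
    h19, h20, h21, h22, h23, h24⟩ := h
  obtain rfl | rfl | rfl | rfl | rfl | rfl := fin_seven_cases hk
  on_goal 1 => left
  on_goal 2 => right
  on_goal 3 => left
  on_goal 4 => right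
  on_goal 5 => left
  on_goal 6 => right
  all_goals
    simp [InCone, transv, rot, refl, dir, h0, fin_seven_neg]
    refine ⟨?_, ?_, ?_, ?_, ?_, ?_, ?_, ?_, ?_, ?_, ?_, ?_, ?_, ?_, ?_, ?_, ?_, ?_, ?_, ?_, ?_, ?_,
      ?_, ?_, ?_⟩ <;> linarith

theorem rot_neg (k : Fin 7) (s : Fin 7 → ℚ) : rot k (-s) = -rot k s := rfl

theorem refl_neg (s : Fin 7 → ℚ) : refl (-s) = -refl s := rfl

theorem transv_neg (n : ℚ) (s : Fin 7 → ℚ) : transv n (-s) = -transv n s := by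
  funext i
  simp only [transv, Pi.neg_apply]
  ring

theorem refl_refl (s : Fin 7 → ℚ) : refl (refl s) = s := by
  funext i
  simp [refl]

theorem refl_rot (k : Fin 7) (s : Fin 7 → ℚ) : refl (rot k s) = rot (-k) (refl s) := by
  funext i
  exact congrArg s (by abel)

theorem rot_rot (k l : Fin 7) (s : Fin 7 → ℚ) : rot k (rot l s) = rot (k + l) s := by
  funext i
  exact congrArg s (by abel)

theorem rot_zero (s : Fin 7 → ℚ) : rot 0 s = s := by
  funext i
  simp [rot]

theorem dir_neg (i : Fin 7) : dir (-i) = -dir i := by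
  fin_cases i <;> simp [dir, fin_seven_neg]

theorem refl_transv (n : ℚ) (s : Fin 7 → ℚ) : refl (transv n s) = transv (-n) (refl s) := by
  funext i
  simp [refl, transv, dir_neg]

theorem transv_transv (m n : ℚ) (s : Fin 7 → ℚ) :
    transv m (transv n s) = transv (m + n) s := by
  funext i
  have h : dir 0 = 0 := rfl
  simp only [transv, h]
  ring

theorem transv_zero (s : Fin 7 → ℚ) : transv 0 s = s := by
  funext i
  simp [transv]

/-- The union of the cone, its reversal, and their opposites. -/
def InTable (s : Fin 7 → ℚ) : Prop :=
  InCone s ∨ InCone (-s) ∨ InCone (refl s) ∨ InCone (-refl s)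

theorem InTable.neg {s : Fin 7 → ℚ} (h : InTable s) : InTable (-s) := by
  unfold InTable at *
  rw [refl_neg, neg_neg, neg_neg]
  tauto

theorem InTable.refl {s : Fin 7 → ℚ} (h : InTable s) : InTable (refl s) := by
  unfold InTable at *
  rw [refl_refl]
  tauto

theorem InTable.of_neg {s : Fin 7 → ℚ} (h : InTable (-s)) : InTable s := by
  simpa using h.neg

theorem InTable.of_refl {s : Fin 7 → ℚ} (h : InTable (DworkSeptic.refl s)) : InTable s := by
  simpa only [refl_refl] using h.refl

theorem InCone.transv_nat {s : Fin 7 → ℚ} (h : InCone s) (n : ℕ) : InCone (transv n s) := by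
  induction n with
  | zero => simpa [transv_zero] using h
  | succ n ih =>
    have := ih.transv_one
    rwa [transv_transv, add_comm, ← Nat.cast_succ] at this

theorem inTable_transv_of_or {s : Fin 7 → ℚ} (h : InCone (transv 1 s) ∨ InCone (-transv 1 s))
    (n : ℕ) : InTable (transv (n + 1) s) := by
  rw [← transv_transv]
  rcases h with h | h
  · exact Or.inl (h.transv_nat n)
  · refine Or.inr (Or.inl ?_)
    rw [← transv_neg]
    exact h.transv_nat n

theorem InTable.transv_rot_nat {s : Fin 7 → ℚ} (h : InTable s) {k : Fin 7} (hk : k ≠ 0) (n : ℕ) :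
    InTable (transv (n + 1) (rot k s)) := by
  rcases h with h | h | h | h
  · exact inTable_transv_of_or (h.transv_rot hk) n
  · apply InTable.of_neg
    rw [← transv_neg, ← rot_neg]
    exact inTable_transv_of_or (h.transv_rot hk) n
  · have := inTable_transv_of_or (h.transv_rot_refl hk) n
    rwa [refl_refl] at this
  · apply InTable.of_neg
    have := inTable_transv_of_or (h.transv_rot_refl hk) n
    rwa [refl_neg, refl_refl, rot_neg, transv_neg] at this

theorem InTable.transv_rot_int {s : Fin 7 → ℚ} (h : InTable s) {k : Fin 7} (hk : k ≠ 0) {n : ℤ}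
    (hn : n ≠ 0) : InTable (transv n (rot k s)) := by
  obtain ⟨m, rfl | rfl⟩ : ∃ m : ℕ, n = m + 1 ∨ n = -(m + 1) := ⟨n.natAbs - 1, by lia⟩
  · exact_mod_cast h.transv_rot_nat hk m
  · apply InTable.of_refl
    rw [refl_transv, refl_rot]
    exact_mod_cast h.refl.transv_rot_nat (neg_ne_zero.mpr hk) m

theorem InTable.not_rot {s : Fin 7 → ℚ} (h : InTable s) {k : Fin 7} (hk : k ≠ 0) :
    ¬ InTable (rot k s) := by
  intro h'
  obtain rfl | rfl | rfl | rfl | rfl | rfl := fin_seven_cases hk <;>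
  rcases h with h | h | h | h <;> rcases h' with h' | h' | h' | h' <;>
  · obtain ⟨a0, a1, a2, a3, a4, a5, a6⟩ := h.signs
    obtain ⟨b0, b1, b2, b3, b4, b5, b6⟩ := h'.signs
    simp [rot, DworkSeptic.refl, fin_seven_neg] at *
    linarith

def PairFamily (G H : Type) : Bool → Type
  | false => G
  | true => H

instance (G H : Type) [Group G] [Group H] : ∀ b, Group (PairFamily G H b)
  | false => inferInstanceAs (Group G)
  | true => inferInstanceAs (Group H)

/-- The ping-pong lemma for the free product of two groups. -/
theorem coprod_hom_injective_of_ping_pong {G H K α : Type} [Group G] [Group H] [Group K]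
    [MulAction K α] (ψ : Monoid.Coprod G H →* K) (hcard : 3 ≤ Cardinal.mk G) (X Y : Set α)
    (hX : X.Nonempty) (hY : Y.Nonempty) (hXY : Disjoint X Y)
    (hG : ∀ g : G, g ≠ 1 → ∀ y ∈ Y, ψ (Monoid.Coprod.inl g) • y ∈ X)
    (hH : ∀ h : H, h ≠ 1 → ∀ x ∈ X, ψ (Monoid.Coprod.inr h) • x ∈ Y) :
    Function.Injective ψ := by
  let f : ∀ b, PairFamily G H b →* K
    | false => ψ.comp Monoid.Coprod.inl
    | true => ψ.comp Monoid.Coprod.inr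
  let e : ∀ b, PairFamily G H b →* Monoid.Coprod G H
    | false => Monoid.Coprod.inl
    | true => Monoid.Coprod.inr
  let toI : Monoid.Coprod G H →* Monoid.CoprodI (PairFamily G H) :=
    Monoid.Coprod.lift (Monoid.CoprodI.of (M := PairFamily G H) (i := false))
      (Monoid.CoprodI.of (M := PairFamily G H) (i := true))
  let ofI : Monoid.CoprodI (PairFamily G H) →* Monoid.Coprod G H :=
    Monoid.CoprodI.lift e
  have hinv : ofI.comp toI = MonoidHom.id _ := by
    exact Monoid.Coprod.hom_ext
      (MonoidHom.ext fun x => Monoid.CoprodI.lift_of (M := PairFamily G H) (i := false) e x)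
      (MonoidHom.ext fun x => Monoid.CoprodI.lift_of (M := PairFamily G H) (i := true) e x)
  have hψ : ψ = (Monoid.CoprodI.lift f).comp toI := by
    exact Monoid.Coprod.hom_ext
      (MonoidHom.ext fun x =>
        (Monoid.CoprodI.lift_of (M := PairFamily G H) (i := false) f x).symm)
      (MonoidHom.ext fun x =>
        (Monoid.CoprodI.lift_of (M := PairFamily G H) (i := true) f x).symm)
  have hinj : Function.Injective (Monoid.CoprodI.lift f) := by
    refine Monoid.CoprodI.lift_injective_of_ping_pong f (Or.inr ⟨false, hcard⟩)
      (fun b => cond b Y X) ?_ ?_ ?_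
    · rintro (_ | _)
      exacts [hX, hY]
    · rintro (_ | _) (_ | _) h
      exacts [(h rfl).elim, hXY, hXY.symm, (h rfl).elim]
    · rintro (_ | _) (_ | _) h
      · exact (h rfl).elim
      · rintro g hg _ ⟨y, hy, rfl⟩
        exact hG g hg y hy
      · rintro g hg _ ⟨y, hy, rfl⟩
        exact hH g hg y hy
      · exact (h rfl).elim
  rw [hψ, MonoidHom.coe_comp]
  exact hinj.comp (Function.LeftInverse.injective (g := ofI) (DFunLike.congr_fun hinv))

theorem companionMatrix_cyclotomic_mulVec (x : Fin 6 → ℚ) :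
    companionMatrix 6 (X ^ 6 + X ^ 5 + X ^ 4 + X ^ 3 + X ^ 2 + X + 1) *ᵥ x =
      ![-x 5, x 0 - x 5, x 1 - x 5, x 2 - x 5, x 3 - x 5, x 4 - x 5] := by
  funext i
  fin_cases i <;>
    simp [companionMatrix, mulVec, dotProduct, Fin.sum_univ_six, coeff_X, coeff_one] <;> ring

theorem companionMatrix_unipotent_mulVec (x : Fin 6 → ℚ) :
    companionMatrix 6 ((X - 1) ^ 6) *ᵥ x =
      ![-x 5, x 0 + 6 * x 5, x 1 - 15 * x 5, x 2 + 20 * x 5, x 3 - 15 * x 5, x 4 + 6 * x 5] := by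
  have h (k : ℕ) : ((X - 1 : ℚ[X]) ^ 6).coeff k = (-1) ^ (6 - k) * (Nat.choose 6 k : ℚ) := by
    simpa [← sub_eq_add_neg] using coeff_X_add_C_pow (-1 : ℚ) 6 k
  funext i
  fin_cases i <;>
    simp [companionMatrix, mulVec, dotProduct, Fin.sum_univ_six, h, Nat.choose] <;> ring

/-- The consecutive differences of the coordinates, which identify `ℚ⁶` with the hyperplane
`∑ i, s i = 0` of `ℚ⁷`. -/
def diff (x : Fin 6 → ℚ) : Fin 7 → ℚ :=
  ![x 0, x 1 - x 0, x 2 - x 1, x 3 - x 2, x 4 - x 3, x 5 - x 4, -x 5]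

theorem diff_injective : Function.Injective diff := by
  intro x y h
  simp only [diff, vecCons_inj] at h
  obtain ⟨h0, h1, h2, h3, h4, h5, h6, -⟩ := h
  funext i
  fin_cases i <;> simp <;> linarith

/-- The tautological action of the general linear group on column vectors. -/
instance : MulAction (GL (Fin 6) ℚ) (Fin 6 → ℚ) where
  smul g x := (g : Matrix (Fin 6) (Fin 6) ℚ) *ᵥ x
  one_smul x := one_mulVec x
  mul_smul g h x := (mulVec_mulVec x (g : Matrix (Fin 6) (Fin 6) ℚ) h).symm

theorem smul_eq_mulVec (g : GL (Fin 6) ℚ) (x : Fin 6 → ℚ) :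
    g • x = (g : Matrix (Fin 6) (Fin 6) ℚ) *ᵥ x := rfl

theorem eq_one_of_diff_smul {g : GL (Fin 6) ℚ} (h : ∀ x : Fin 6 → ℚ, diff (g • x) = diff x) :
    g = 1 := by
  apply Units.ext
  apply Matrix.ext_of_mulVec_single
  intro i
  rw [← smul_eq_mulVec, Units.val_one, one_mulVec]
  exact diff_injective (h _)

theorem diff_smul_of_cyclotomic {B : GL (Fin 6) ℚ}
    (hB : (B : Matrix (Fin 6) (Fin 6) ℚ) =
      companionMatrix 6 (X ^ 6 + X ^ 5 + X ^ 4 + X ^ 3 + X ^ 2 + X + 1)) (x : Fin 6 → ℚ) :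
    diff (B • x) = rot 1 (diff x) := by
  rw [smul_eq_mulVec, hB, companionMatrix_cyclotomic_mulVec]
  funext i
  fin_cases i <;> simp [diff, rot, fin_seven_neg]

theorem diff_smul_mul_inv {A B : GL (Fin 6) ℚ}
    (hA : (A : Matrix (Fin 6) (Fin 6) ℚ) = companionMatrix 6 ((X - 1) ^ 6))
    (hB : (B : Matrix (Fin 6) (Fin 6) ℚ) =
      companionMatrix 6 (X ^ 6 + X ^ 5 + X ^ 4 + X ^ 3 + X ^ 2 + X + 1)) (x : Fin 6 → ℚ) :
    diff ((B * A⁻¹) • x) = transv 1 (diff x) := by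
  obtain ⟨y, rfl⟩ : ∃ y, x = A • y := ⟨A⁻¹ • x, (smul_inv_smul A x).symm⟩
  rw [mul_smul, inv_smul_smul, smul_eq_mulVec, smul_eq_mulVec, hA, hB,
    companionMatrix_cyclotomic_mulVec, companionMatrix_unipotent_mulVec]
  funext i
  fin_cases i <;> simp [diff, transv, dir] <;> ring

open scoped Fin.NatCast in
theorem diff_pow_smul {B : GL (Fin 6) ℚ} (hB : ∀ x : Fin 6 → ℚ, diff (B • x) = rot 1 (diff x))
    (k : ℕ) (x : Fin 6 → ℚ) : diff (B ^ k • x) = rot (k : Fin 7) (diff x) := by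
  induction k with
  | zero => simp [rot_zero]
  | succ k ih => rw [pow_succ', mul_smul, hB, ih, rot_rot, add_comm, Nat.cast_succ]

theorem diff_zpow_smul {T : GL (Fin 6) ℚ} (hT : ∀ x : Fin 6 → ℚ, diff (T • x) = transv 1 (diff x))
    (n : ℤ) (x : Fin 6 → ℚ) : diff (T ^ n • x) = transv n (diff x) := by
  have key (n : ℕ) (x : Fin 6 → ℚ) : diff (T ^ n • x) = transv n (diff x) := by
    induction n with
    | zero => simp [transv_zero]
    | succ n ih => rw [pow_succ', mul_smul, hT, ih, transv_transv, add_comm, Nat.cast_succ]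
  obtain ⟨m, rfl | rfl⟩ := n.eq_nat_or_neg
  · simpa using key m x
  · have h := key m ((T ^ m)⁻¹ • x)
    rw [smul_inv_smul] at h
    simp [h, transv_transv, transv_zero]

theorem inTable_diff_base : InTable (diff ![1, 5, -11, 19, -13, 7]) := by
  refine Or.inl ?_
  simp only [InCone, diff]
  simp
  norm_num

end DworkSeptic

/-- The hypergeometric group of case A37 is isomorphic to `ℤ ∗ ℤ/7ℤ`, freely
generated by `T = B * A⁻¹` (of infinite order) and `B` (of order 7). -/
theorem thm_A37 (A B : GL (Fin 6) ℚ)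
    (hA : (A : Matrix (Fin 6) (Fin 6) ℚ) = companionMatrix 6 ((X - 1) ^ 6))
    (hB : (B : Matrix (Fin 6) (Fin 6) ℚ) = companionMatrix 6 (X ^ 6 + X ^ 5 + X ^ 4 + X ^ 3 + X ^ 2 + X + 1)) :
    B ^ 7 = 1 ∧ B ≠ 1 ∧ ¬ IsOfFinOrder (B * A⁻¹) ∧
      ∀ ψ : Monoid.Coprod (Multiplicative ℤ) (Multiplicative (ZMod 7)) →* GL (Fin 6) ℚ,
        ψ (Monoid.Coprod.inl (Multiplicative.ofAdd (1 : ℤ))) = B * A⁻¹ →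
        ψ (Monoid.Coprod.inr (Multiplicative.ofAdd (1 : ZMod 7))) = B →
        Function.Injective ψ := by
  have hBx := DworkSeptic.diff_smul_of_cyclotomic hB
  have hTx := DworkSeptic.diff_smul_mul_inv hA hB
  generalize B * A⁻¹ = T at *
  have hBk := DworkSeptic.diff_pow_smul hBx
  have hTn := DworkSeptic.diff_zpow_smul hTx
  refine ⟨?_, ?_, ?_, ?_⟩
  · refine DworkSeptic.eq_one_of_diff_smul fun x => ?_
    rw [hBk]
    exact DworkSeptic.rot_zero _
  · rintro rfl
    have h := congrFun (hBx ![1, 0, 0, 0, 0, 0]) 0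
    simp [DworkSeptic.diff, DworkSeptic.rot, DworkSeptic.fin_seven_neg] at h
  · rw [isOfFinOrder_iff_pow_eq_one]
    rintro ⟨n, hn, h⟩
    have h' := congrFun (hTn n ![1, 0, 0, 0, 0, 0]) 1
    rw [zpow_natCast, h, one_smul] at h'
    simp [DworkSeptic.diff, DworkSeptic.transv, DworkSeptic.dir] at h'
    lia
  · intro ψ hψT hψB
    have hl (n : Multiplicative ℤ) : ψ (Monoid.Coprod.inl n) = T ^ n.toAdd := by
      rw [← hψT, ← map_zpow, ← map_zpow, ← ofAdd_zsmul]
      simp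
    have hr (k : Multiplicative (ZMod 7)) : ψ (Monoid.Coprod.inr k) = B ^ k.toAdd.val := by
      rw [← hψB, ← map_pow, ← map_pow, ← ofAdd_nsmul]
      simp
    refine DworkSeptic.coprod_hom_injective_of_ping_pong ψ ?_
      {x : Fin 6 → ℚ | DworkSeptic.InTable (DworkSeptic.diff x)}
      {x : Fin 6 → ℚ | ∃ k ≠ 0, ∃ s, DworkSeptic.InTable s ∧
        DworkSeptic.diff x = DworkSeptic.rot k s} ?_ ?_ ?_ ?_ ?_
    · exact (Cardinal.natCast_lt_aleph0 (n := 3)).le.trans (Cardinal.aleph0_le_mk _)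
    · exact ⟨_, DworkSeptic.inTable_diff_base⟩
    · exact ⟨_, 1, by decide, _, DworkSeptic.inTable_diff_base, hBx _⟩
    · rw [Set.disjoint_left]
      rintro x hx ⟨k, hk, s, hs, h⟩
      exact hs.not_rot hk (h ▸ hx)
    · rintro n hn x ⟨k, hk, s, hs, h⟩
      change DworkSeptic.InTable (DworkSeptic.diff (_ • x))
      rw [hl, hTn, h]
      exact hs.transv_rot_int hk (by simpa using hn)
    · intro k hk x hx
      refine ⟨k.toAdd, fun h => hk (toAdd_eq_zero.mp h), _, hx, ?_⟩
      rw [hr, hBk]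
      exact congrArg (DworkSeptic.rot · _) (ZMod.natCast_zmod_val k.toAdd)
end

section
/- Let A be the companion matrix of f(x) = (x−1)⁶ and B the companion matrix of the ninth cyclotomic polynomial g(x) = x⁶+x³+1, regarded as elements of GL₆(ℚ), and set T = B·A⁻¹. Then B⁹ = I, B has order 9, T has infinite order, and the group homomorphism from the free product ℤ ∗ (ℤ/9ℤ) to GL₆(ℚ) sending the generator 1 of ℤ to T and the generator 1 of ℤ/9ℤ to B is injective; in particular the group ⟨A,B⟩ is isomorphic to ℤ ∗ ℤ/9ℤ. (This is the hypergeometric monodromy group of case A-38, with α = (0,0,0,0,0,0) and β = (1/9,2/9,4/9,5/9,7/9,8/9).) -/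
open Matrix Polynomial

namespace A38

/-- The table-tennis lemma for a free product `H ∗ P`, with one set `S` that the nontrivial elements
of `P` move off a point of it, and into which every `h * p` with `h ≠ 1` and `p ≠ 1` maps it. -/
theorem coprod_injective_of_ping_pong {H P G α : Type} [Group H] [Group P] [Group G]
    [MulAction G α] [Infinite H] [Nontrivial P] (f : Monoid.Coprod H P →* G) (S : Set α) (x₀ : α)
    (hx₀ : x₀ ∈ S) (hmove : ∀ p : P, p ≠ 1 → f (Monoid.Coprod.inr p) • x₀ ∉ S)
    (hmaps : ∀ h : H, h ≠ 1 → ∀ p : P, p ≠ 1 → ∀ x ∈ S,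
      f (Monoid.Coprod.inl h) • f (Monoid.Coprod.inr p) • x ∈ S) :
    Function.Injective f := by
  let F : Bool → Type := fun i => cond i H P
  let _ : ∀ i, Group (F i) := fun i => match i with
    | true => (inferInstance : Group H)
    | false => (inferInstance : Group P)
  let inlH : H →* Monoid.CoprodI F := Monoid.CoprodI.of (M := F) (i := true)
  let inrP : P →* Monoid.CoprodI F := Monoid.CoprodI.of (M := F) (i := false)
  let g : ∀ i, F i →* Monoid.Coprod H P := fun i => match i with
    | true => Monoid.Coprod.inl
    | false => Monoid.Coprod.inr
  let back : Monoid.Coprod H P →* Monoid.CoprodI F := Monoid.Coprod.lift inlH inrP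
  have hback : ∀ x, Monoid.CoprodI.lift g (back x) = x := by
    intro x
    have : (Monoid.CoprodI.lift g).comp back = MonoidHom.id _ := by
      apply Monoid.Coprod.hom_ext
      · ext h
        change Monoid.CoprodI.lift g (back (Monoid.Coprod.inl h)) = Monoid.Coprod.inl h
        rw [Monoid.Coprod.lift_apply_inl]
        exact Monoid.CoprodI.lift_of (i := true) g h
      · ext p
        change Monoid.CoprodI.lift g (back (Monoid.Coprod.inr p)) = Monoid.Coprod.inr p
        rw [Monoid.Coprod.lift_apply_inr]
        exact Monoid.CoprodI.lift_of (i := false) g p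
    exact DFunLike.congr_fun this x
  have key : Function.Injective (Monoid.CoprodI.lift fun i => f.comp (g i)) := by
    let Y : Set α := {y | ∃ p : P, p ≠ 1 ∧ ∃ x ∈ S, f (Monoid.Coprod.inr p) • x = y}
    have hx₀Y : x₀ ∉ Y := by
      rintro ⟨p, hp, x, hx, hpx⟩
      apply hmove p⁻¹ (inv_ne_one.mpr hp)
      rwa [← hpx, smul_smul, ← map_mul, ← map_mul, inv_mul_cancel, map_one, map_one, one_smul]
    refine Monoid.CoprodI.lift_injective_of_ping_pong (fun i => f.comp (g i))
      (Or.inr ⟨true, ?_⟩) (fun i => cond i (S \ Y) (Y \ S)) ?_ ?_ ?_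
    · have : Cardinal.aleph0 ≤ Cardinal.mk H := Cardinal.infinite_iff.mp ‹Infinite H›
      exact (Cardinal.natCast_le_aleph0 (n := 3)).trans this
    · rintro (_ | _)
      · obtain ⟨p, hp⟩ := exists_ne (1 : P)
        exact ⟨f (Monoid.Coprod.inr p) • x₀, ⟨p, hp, x₀, hx₀, rfl⟩, hmove p hp⟩
      · exact ⟨x₀, hx₀, hx₀Y⟩
    · rintro (_ | _) (_ | _) hij
      · exact absurd rfl hij
      · exact disjoint_sdiff_sdiff
      · exact disjoint_sdiff_sdiff
      · exact absurd rfl hij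
    · rintro (_ | _) (_ | _) hij
      · exact absurd rfl hij
      · rintro (p : P) (hp : p ≠ 1) _ ⟨x, ⟨hxS, hxY⟩, rfl⟩
        refine ⟨⟨p, hp, x, hxS, rfl⟩, fun hS => hxY ⟨p⁻¹, inv_ne_one.mpr hp, _, hS, ?_⟩⟩
        change f (Monoid.Coprod.inr p⁻¹) • f (Monoid.Coprod.inr p) • x = x
        rw [smul_smul, ← map_mul, ← map_mul, inv_mul_cancel, map_one, map_one, one_smul]
      · rintro (h : H) (hh : h ≠ 1) _ ⟨y, ⟨⟨p, hp, x, hx, rfl⟩, hyS⟩, rfl⟩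
        refine ⟨hmaps h hh p hp x hx, ?_⟩
        rintro ⟨q, hq, z, hz, hqz⟩
        apply hyS
        have := hmaps h⁻¹ (inv_ne_one.mpr hh) q hq z hz
        rw [hqz] at this
        change f (Monoid.Coprod.inl h⁻¹) • f (Monoid.Coprod.inl h) •
          f (Monoid.Coprod.inr p) • x ∈ S at this
        rwa [smul_smul, ← map_mul, ← map_mul, inv_mul_cancel, map_one, map_one, one_smul] at this
      · exact absurd rfl hij
  have hcomp : (Monoid.CoprodI.lift fun i => f.comp (g i)) = f.comp (Monoid.CoprodI.lift g) := by
    apply Monoid.CoprodI.ext_hom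
    intro i
    ext x
    simp
  rw [hcomp] at key
  intro x y hxy
  rw [← hback x, ← hback y] at hxy ⊢
  exact congrArg _ (key hxy)

/-- The companion matrix of `x⁶ + x³ + 1`, as a linear map. -/
def companionMap (K : Type) [CommRing K] : Module.End K (Fin 6 → K) where
  toFun v := ![-v 5, v 0, v 1, v 2 - v 5, v 3, v 4]
  map_add' v w := by ext i; fin_cases i <;> simp <;> ring
  map_smul' a v := by ext i; fin_cases i <;> simp <;> ring

/-- The transvection `B * A⁻¹`, as a linear map. -/
def transvection (K : Type) [CommRing K] : Module.End K (Fin 6 → K) where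
  toFun v := ![v 0, v 1 + 6 * v 0, v 2 - 15 * v 0, v 3 + 21 * v 0, v 4 - 15 * v 0, v 5 + 6 * v 0]
  map_add' v w := by ext i; fin_cases i <;> simp <;> ring
  map_smul' a v := by ext i; fin_cases i <;> simp <;> ring

/-- An involution conjugating both `companionMap` and `transvection` to their inverses. -/
def reflection (K : Type) [CommRing K] : Module.End K (Fin 6 → K) where
  toFun v := ![-v 0, v 5, v 4, v 3 - v 0, v 2, v 1]
  map_add' v w := by ext i; fin_cases i <;> simp <;> ring
  map_smul' a v := by ext i; fin_cases i <;> simp <;> ring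

/-- The vector spanning the image of `transvection - 1`. -/
def direction (K : Type) [CommRing K] : Fin 6 → K := ![0, -6, 15, -21, 15, -6]

/-- Generators of a cone that the maps `± transvection * companionMap ^ i` with `1 ≤ i ≤ 8` map into
itself; the same maps preceded by `reflection` do so too. -/
def ray : Fin 12 → Fin 6 → ℤ :=
  ![![-641, -1658, 5606, -8978, 6667, -2919],
    ![-1017, -2684, 10927, -19173, 15284, -6388],
    ![-1667, -2493, 11177, -21907, 18588, -8699],
    ![-59, -92, 427, -847, 722, -328],
    ![-1, -1, 5, -11, 10, -5],
    ![-90, -1367, 3405, -3929, 2102, -633],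
    ![144, -627, 1283, -1450, 894, -249],
    ![-18, -887, 1617, -1731, 952, -497],
    ![-828, -2731, 9718, -15528, 11556, -4676],
    ![-15, -481, 1260, -2259, 2022, -978],
    ![-2110, -5154, 20301, -35392, 28043, -12021],
    ![-2904, -5982, 24799, -45172, 36779, -16232]]

/-- Coefficients expressing the images of the generators under the maps
`± transvection * companionMap ^ i`, up to the factors `weightDenom`, in terms of the generators. -/
def weight : Fin 8 → Fin 12 → Fin 12 → ℕ :=
  ![![![0, 3747227560064, 0, 0, 6184312105518810, 1264024918329, 11060606224672, 30079405688331, 0, 1957881684496, 0, 0],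
      ![0, 614332191891, 0, 986145238525, 1159532190581044, 0, 1760363444070, 6367252408902, 0, 762108228882, 0, 0],
      ![0, 341915842558, 0, 0, 757745045562788, 191154417557, 1058846727866, 3747054268781, 0, 260912857441, 0, 0],
      ![0, 324431000496, 0, 0, 646345626404090, 354154991769, 460201244874, 3594660492795, 0, 965920524138, 0, 0],
      ![0, 3291783954, 0, 0, 4417697452466, 580465902, 4334200146, 30613637700, 0, 2539397121, 0, 0],
      ![0, 565932941944, 0, 0, 618753373088193, 384834672974, 1989790691549, 1566643168136, 0, 978480619826, 0, 0],
      ![0, 28511465103, 0, 72978623117, 41786165956640, 0, 96123345780, 241268722464, 0, 84133177128, 0, 0],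
      ![0, 498117831, 0, 30500652053, 1796247887126, 5571310017, 6206060616, 6002546445, 0, 0, 0, 0],
      ![0, 82540606181, 0, 121187826290, 139557687588571, 0, 249001111667, 732669749658, 0, 83383682382, 0, 0],
      ![0, 2158021217, 0, 38792719533, 2057499336942, 0, 2591647674, 29491822052, 0, 2265393130, 0, 0],
      ![0, 13959910166400, 0, 0, 26973588618669468, 498620071065, 44295113163768, 136128509273117, 0, 8986803009474, 0, 0],
      ![0, 8916084781717, 0, 0, 18169367175895040, 2160537254925, 27278796565784, 91678800243138, 0, 7479766921691, 0, 0]],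
    ![![0, 3924735597, 0, 70981057031, 6794983320818, 11305396011, 7741364568, 49030509423, 0, 0, 0, 0],
      ![0, 1110511070691, 0, 28449332371177, 1984838353678894, 4278340559493, 2067741072936, 15909038115201, 0, 0, 0, 0],
      ![0, 86864244489, 0, 2226782576827, 140567034620362, 358198695855, 141850818648, 1144600140915, 0, 0, 0, 0],
      ![0, 16872115887, 0, 579297912909, 22509247136614, 70594412889, 22895210184, 247131292485, 0, 0, 0, 0],
      ![0, 79361469, 0, 4204966135, 184250368274, 613383771, 222257112, 1506890847, 0, 0, 0, 0],
      ![0, 138133955157, 0, 413647878463, 202552704495106, 2223928707, 261555728280, 1404976831335, 0, 0, 0, 0],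
      ![0, 84802933347, 0, 1232205228649, 139238900426542, 141471567237, 192298243368, 1053923527041, 0, 0, 0, 0],
      ![0, 537729525033, 0, 0, 793681831379629, 1104072530323, 349064982977, 3862645485440, 0, 1509575594244, 0, 0],
      ![0, 19311013535, 0, 384569592765, 34576145434950, 58468394985, 37865312408, 259182341957, 0, 0, 0, 0],
      ![0, 74192698371, 0, 3920774454601, 330163719140206, 877679263461, 424623126312, 1594490855265, 0, 0, 0, 0],
      ![0, 2132019982389, 0, 49410522879583, 3741094281856834, 7763128600227, 3930888023832, 29003587292295, 0, 0, 0, 0],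
      ![0, 86242129083, 0, 2137951818953, 145351452548414, 331363917885, 149990051904, 1171423820721, 0, 0, 0, 0]],
    ![![0, 312583183275, 0, 5362800108865, 772041610767742, 2052353716413, 867172689768, 2845453904601, 0, 0, 0, 0],
      ![0, 40633313711, 0, 572959420749, 107596581885030, 289823354457, 125349830088, 313023026757, 0, 0, 0, 0],
      ![0, 819916323039, 0, 8522665694173, 2142478463207110, 5451004792233, 2545835785416, 5522932113237, 0, 0, 0, 0],
      ![0, 18343801311, 0, 170129647581, 61609606336838, 151201227177, 74543439432, 125522096469, 0, 0, 0, 0],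
      ![0, 4643610762, 0, 0, 11398020283241, 25996155762, 12175977273, 22028917536, 0, 1234891950, 0, 0],
      ![0, 2684560321, 0, 132349452803, 7691774904954, 24116644279, 8240702904, 50466332427, 0, 0, 0, 0],
      ![0, 813191115, 0, 18604718161, 2152522970350, 5496667605, 2543213640, 9474565617, 0, 0, 0, 0],
      ![0, 851104197, 0, 21489656975, 936019622930, 2266665219, 945960120, 10405760631, 0, 0, 0, 0],
      ![0, 47118988167, 0, 873578971093, 120985782219862, 335744428929, 137560697736, 429447429453, 0, 0, 0, 0],
      ![0, 1264426970711, 0, 0, 1952379460455786, 4576624475156, 1698565677854, 5602107047984, 0, 651957698784, 0, 0],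
      ![0, 833573518965, 0, 12130887050015, 2146316430911170, 5762987673443, 2492251701016, 6569103358279, 0, 0, 0, 0],
      ![0, 1612207395975, 0, 20914090322773, 4257830123378902, 11196999022209, 5002475930760, 11995402634061, 0, 0, 0, 0]],
    ![![0, 5481186966299, 0, 0, 6655993956037649, 14327101610322, 4882617555082, 22946358203322, 0, 2650512380605, 0, 0],
      ![0, 24533458934314, 0, 0, 23113788615352762, 53152835351155, 7290457761646, 96989119291813, 0, 23926516092698, 0, 0],
      ![0, 14720803555157, 0, 0, 12636241827420361, 26809245059914, 2710211151991, 61629441597505, 0, 13238642187920, 0, 0],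
      ![100749639258, 353556185478, 0, 0, 221683086417350, 514422007755, 0, 1450799385717, 0, 431425681758, 0, 0],
      ![0, 8754916695, 0, 0, 5760135331303, 7505286588, 3353717283, 38461743003, 0, 1110204678, 0, 0],
      ![0, 3843002756378, 0, 0, 7780927359709158, 19020862475067, 7810947645408, 15372237871413, 0, 1169787240292, 0, 0],
      ![0, 912738132407, 0, 0, 1329714155942462, 2694220735766, 1335838244742, 4185264483663, 0, 79671818755, 0, 0],
      ![0, 8001476175, 0, 143658273197, 31013908734758, 78389075193, 35087025864, 78459526629, 0, 0, 0, 0],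
      ![0, 720303080955, 0, 0, 827949763661514, 1908246505631, 478247085243, 2857871998607, 0, 575575863211, 0, 0],
      ![0, 163113548499, 0, 870126354233, 144490199051534, 221363235093, 141082416552, 940595603409, 0, 0, 0, 0],
      ![0, 22388079687842, 0, 0, 22416850440211689, 50331255390499, 9225800469943, 90366156720582, 0, 19802622801695, 0, 0],
      ![0, 58755804085918, 0, 0, 54272419437629418, 121111947258357, 16067900367236, 238878530159499, 0, 54634977666374, 0, 0]],
    ![![0, 490968133623, 0, 5123227272997, 512982307806262, 930644892177, 388177321224, 3589309895325, 0, 0, 0, 0],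
      ![0, 12192215271, 0, 226533857269, 13599366851350, 27283179105, 10003214088, 116321104557, 0, 0, 0, 0],
      ![0, 842388552027, 0, 22152950869585, 1104471829994974, 2677166593101, 816165820008, 9519241045545, 0, 0, 0, 0],
      ![0, 16872115887, 0, 691973419853, 26227538865766, 70594412889, 22895210184, 247131292485, 0, 0, 0, 0],
      ![0, 79361469, 0, 4204966135, 240588121746, 613383771, 222257112, 1506890847, 0, 0, 0, 0],
      ![0, 3026029551885, 0, 0, 2049685304560783, 2364845449507, 1279488712783, 13186982492136, 0, 434748349731, 0, 0],
      ![0, 99513555339, 0, 638729940577, 104261123668030, 176358090909, 91752126312, 625431731001, 0, 0, 0, 0],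
      ![532235116214, 2437608123274, 0, 0, 1805242519546730, 5161356405701, 0, 9051312748715, 0, 2852878805330, 0, 0],
      ![0, 120521424837, 0, 1378483194511, 118478447900386, 204484929363, 86526313368, 924053586423, 0, 0, 0, 0],
      ![0, 4852317921, 0, 108902310403, 13028924807794, 28665031395, 11109832272, 59500361151, 0, 0, 0, 0],
      ![0, 119165359731, 0, 2023825292377, 130813871594062, 262087086261, 95175388968, 1081852285041, 0, 0, 0, 0],
      ![0, 3908133149679, 0, 81192289419533, 4578014651709926, 9943545693081, 3374058883272, 39020349079173, 0, 0, 0, 0]],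
    ![![0, 42673450299, 0, 957676263665, 129149599793438, 346878018669, 87565689960, 474022915401, 0, 0, 0, 0],
      ![0, 295638673055, 0, 6252312914973, 1146988678080966, 3164559030633, 796157753160, 3279624289557, 0, 0, 0, 0],
      ![0, 577407308841, 0, 6426634139579, 2072619022763786, 5581653508431, 1431814479480, 4758177223107, 0, 0, 0, 0],
      ![0, 16101437517, 0, 54539487655, 59487826949810, 149838027339, 40739376216, 116029361679, 0, 0, 0, 0],
      ![0, 8193273186, 0, 0, 18603004110218, 51471658461, 8266895652, 39539391651, 0, 2766189288, 0, 0],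
      ![0, 27819886061, 0, 1453620940423, 82991217642354, 207905604907, 64864971864, 547889435247, 0, 0, 0, 0],
      ![0, 6718504287, 0, 131566851373, 16038644579734, 39100510449, 12145493976, 70666092189, 0, 0, 0, 0],
      ![0, 36935501427, 0, 944877994777, 40699371515278, 99421351029, 33887417256, 371174771121, 0, 0, 0, 0],
      ![0, 99797272047, 0, 2846715194381, 363410991981542, 1003011127833, 253679760840, 1291864648965, 0, 0, 0, 0],
      ![0, 34827590061, 0, 128908330951, 52161770695282, 152979721323, 24851518296, 165837060015, 0, 0, 0, 0],
      ![0, 76001476149, 0, 1611037684447, 282366221644738, 777206972451, 196284736536, 832116384519, 0, 0, 0, 0],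
      ![0, 1107324133971, 0, 18653546180153, 4123317152605070, 11216067916053, 2863819792680, 10931744860113, 0, 0, 0, 0]],
    ![![647685557254, 3172744060082, 0, 0, 3180952211740618, 12215408885857, 0, 6983457726031, 0, 1586250625162, 0, 0],
      ![64658079974, 50393962198, 0, 0, 23514210052082, 166997304557, 0, 55392818483, 0, 72872785202, 0, 0],
      ![22109592620534, 13401130778698, 0, 0, 1204919765370218, 29543291684021, 0, 12621270650171, 0, 19582856313650, 0, 0],
      ![90720997931144, 80434595943973, 0, 0, 0, 112675027063319, 0, 107382583511663, 7509357395244, 51009133048400, 0, 0],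
      ![22863720, 47531781, 0, 60069359, 5695799106, 59246319, 0, 64509027, 0, 0, 0, 0],
      ![0, 104809155, 0, 146423735, 255058665614, 749891428, 127393090, 486548722, 0, 0, 0, 0],
      ![0, 49731879065, 0, 105405969547, 70111373501162, 206762402847, 30924340216, 194417635027, 0, 0, 0, 0],
      ![0, 15017246981, 0, 111531189071, 59193302542178, 142051568659, 36358615832, 139053554871, 0, 0, 0, 0],
      ![3232665759134, 5060289929698, 0, 0, 4641627098078954, 21023397037769, 0, 8933294993111, 0, 5284922345234, 0, 0],
      ![0, 9704379839, 0, 16554553725, 7406660721414, 23185792201, 2816157256, 19314606069, 0, 0, 0, 0],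
      ![25843512223882, 21948575651558, 0, 0, 11905658908318486, 74585561909683, 0, 28077851521453, 0, 29919278585086, 0, 0],
      ![19244846382166, 14044747606154, 0, 0, 4857640841657554, 40562254692217, 0, 15863096853151, 0, 19539233308930, 0, 0]],
    ![![1, 1, 0, 0, 0, 0, 0, 0, 0, 0, 0, 0],
      ![0, 1, 1, 0, 0, 0, 0, 0, 0, 0, 0, 0],
      ![0, 0, 1, 14, 0, 0, 0, 0, 0, 0, 0, 0],
      ![0, 0, 0, 1, 33, 0, 0, 0, 0, 0, 0, 0],
      ![0, 0, 0, 0, 1, 0, 0, 0, 0, 0, 0, 0],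
      ![76201824141610, 126211578663638, 0, 0, 0, 157906802500348, 0, 16023416808128, 381412676630412, 103019718787035, 0, 0],
      ![2931330248, 36528101159, 0, 13922246501, 22120463629558, 66759138677, 0, 62765686137, 0, 0, 0, 0],
      ![102530423514, 105471393422, 0, 0, 17685302046950, 219224552927, 0, 129098699385, 0, 8602951826, 0, 0],
      ![0, 9973921541951, 9968515842829, 0, 0, 0, 0, 2023119385394, 11749863338240, 690019937539, 1510677345976787, 0],
      ![341426738317, 175702583, 39011254180, 0, 34400302648653, 0, 0, 295876310107, 0, 311199787822, 0, 0],
      ![0, 748170897423, 1061705057644, 639932424767, 0, 0, 449999308024, 0, 558553591904, 0, 0, 116968307583274],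
      ![0, 23232, 62403, 708368, 2619899, 0, 0, 0, 0, 0, 0, 55902]]]

/-- The denominators that go with `weight`. -/
def weightDenom : Fin 8 → Fin 12 → ℕ :=
  ![![3113078111702, 268478464254, 119733773527, 3113078111702, 1556539055851, 1556539055851, 268478464254, 7682420928, 44746410709, 6884063186, 3113078111702, 1556539055851],
    ![2363821824, 338026520832, 21126657552, 112675506944, 56337753472, 169013260416, 338026520832, 1556539055851, 7042219184, 338026520832, 338026520832, 10563328776],
    ![169013260416, 10243227904, 169013260416, 112675506944, 1556539055851, 5121613952, 3018093936, 1920605232, 15364841856, 1556539055851, 112675506944, 169013260416],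
    ![1556539055851, 3113078111702, 1556539055851, 959886093616, 1556539055851, 3113078111702, 1556539055851, 24144751488, 119733773527, 169013260416, 1556539055851, 3113078111702],
    ![169013260416, 2363821824, 169013260416, 112675506944, 56337753472, 1556539055851, 169013260416, 2879658280848, 24144751488, 10563328776, 12072375744, 338026520832],
    ![30729683712, 112675506944, 169013260416, 112675506944, 3113078111702, 56337753472, 21126657552, 84506630208, 48289502976, 48289502976, 15364841856, 169013260416],
    ![1439829140424, 12201941868, 2879658280848, 372390322264123, 15745737656, 125753914, 112675506944, 56337753472, 1439829140424, 16096500992, 2879658280848, 1439829140424],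
    ![1, 1, 1, 1, 1, 372390322264123, 110220163592, 239971523404, 1180544067162667, 682867073917, 66480821855336, 55902]]

/-- The analogue of `weight` for the maps `± transvection * companionMap ^ i * reflection`. -/
def reflWeight : Fin 8 → Fin 12 → Fin 12 → ℕ :=
  ![![![0, 148167151803, 0, 1547294932879, 199475469965254, 0, 275933106372, 1736839944378, 0, 810445177542, 0, 0],
      ![0, 1687604117945, 0, 0, 2582258908883825, 848335720421, 4013143055708, 11790539716847, 0, 11234079956734, 0, 0],
      ![0, 1600746698894, 0, 0, 6526666898893104, 8134260396997, 11886459020326, 11534671395151, 0, 25214667925952, 0, 0],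
      ![0, 0, 271722933, 0, 232206417005431, 197969635227, 560060043648, 154501888065, 0, 405474372030, 0, 0],
      ![0, 19003083, 0, 24700449, 74318934718, 11552541, 286475112, 80446905, 0, 0, 0, 0],
      ![0, 7095384945, 4135410147, 181543652989, 8993029416853, 0, 0, 167118190470, 0, 51469139106, 0, 0],
      ![0, 82068180645, 0, 143831232431, 137001442837154, 36572146611, 233433189528, 739704966231, 0, 0, 0, 0],
      ![0, 495401511, 0, 2405797301, 654385850006, 287768481, 726409992, 5521530861, 0, 0, 0, 0],
      ![0, 276080803515, 0, 2141111176151, 284899358242898, 0, 235492459356, 2717867811582, 0, 1746992307060, 0, 0],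
      ![0, 101633420757, 0, 167312675135, 77378285046146, 44541147651, 276121132056, 429587469927, 0, 0, 0, 0],
      ![0, 3193275680474, 0, 0, 5030947368320043, 1533674122029, 7800279545549, 24047116378328, 0, 19750336484033, 0, 0],
      ![0, 233551244093, 0, 0, 509843728767294, 346757688022, 856343350098, 1749162285637, 0, 1966827905287, 0, 0]],
    ![![0, 4882584399, 0, 110110191149, 8530585236902, 12644667321, 10986808008, 70851386661, 0, 0, 0, 0],
      ![0, 568479053175, 0, 8711724038821, 712500055992886, 462620086929, 897134498568, 7206915842973, 0, 0, 0, 0],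
      ![0, 1543907109195, 0, 11187572478241, 1543983391784638, 55853899101, 1953541547496, 15566769844857, 0, 0, 0, 0],
      ![0, 17334768033, 0, 59618096455, 15999994753008, 0, 13252091622, 159246121650, 0, 7225614396, 0, 0],
      ![0, 3291783954, 0, 0, 4417697452466, 580465902, 4334200146, 30613637700, 0, 2539397121, 0, 0],
      ![0, 55460996085, 0, 4341017093279, 211690145745218, 663315303651, 255115196952, 1573020860103, 0, 0, 0, 0],
      ![0, 13726237767, 0, 292969673237, 27016855677398, 55795495041, 31050497544, 174636622413, 0, 0, 0, 0],
      ![0, 16309066455, 0, 940468450885, 54090669772342, 184115524593, 78835456392, 292472255229, 0, 0, 0, 0],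
      ![0, 768623899527, 0, 19017379294421, 1245663140344406, 1705806014913, 1590241534728, 11724163587213, 0, 0, 0, 0],
      ![0, 135091300311, 0, 627873559237, 270528071409526, 151005455601, 401902520712, 1402023578109, 0, 0, 0, 0],
      ![0, 257817002553, 0, 4131822380363, 330459893098538, 256832454879, 422424253944, 3281189801043, 0, 0, 0, 0],
      ![0, 1439030782299, 0, 17055221012689, 1653408652690270, 777294859341, 2081616877032, 16555285553961, 0, 0, 0, 0]],
    ![![0, 48076057377, 0, 925200655651, 135335543603386, 351993875415, 160427967672, 488878834731, 0, 0, 0, 0],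
      ![0, 245006130281, 0, 10763337403131, 1001470949189130, 2882457168591, 1210672568952, 4165173242307, 0, 0, 0, 0],
      ![0, 20489343039, 0, 1374576118477, 95216320142566, 282473888697, 120981073752, 480357003357, 0, 0, 0, 0],
      ![0, 7095047751, 0, 690601859861, 33134364082134, 114647485953, 44226437640, 207949743309, 0, 0, 0, 0],
      ![0, 79361469, 0, 4204966135, 184250368274, 613383771, 222257112, 1506890847, 0, 0, 0, 0],
      ![0, 265741648422, 0, 0, 590546633601772, 1423288368253, 634120721322, 1151566663311, 0, 66616925424, 0, 0],
      ![0, 9741910695, 0, 91594033205, 20674815810710, 50653549089, 22903985544, 68872301421, 0, 0, 0, 0],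
      ![0, 1729529303446, 0, 0, 2939856857213004, 7508223429899, 1554524146406, 7440479032393, 0, 3206492822428, 0, 0],
      ![0, 61992503067, 0, 1479353097361, 204386396907742, 549324588813, 241259643240, 712086627945, 0, 0, 0, 0],
      ![0, 57186020375, 0, 1157459102853, 106776494397174, 254511930673, 106487134600, 669285945405, 0, 0, 0, 0],
      ![0, 241739673593, 0, 9397006808363, 933218920777514, 2620978399039, 1129900589048, 3797731636083, 0, 0, 0, 0],
      ![0, 101310038577, 0, 5047003269059, 423229053844394, 1224988123359, 522492326664, 1885387188531, 0, 0, 0, 0]],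
    ![![0, 10841094375824, 0, 0, 12925962697234386, 27607436007715, 9941025591684, 46186001781649, 0, 5367334327348, 0, 0],
      ![0, 21354758105696, 0, 0, 27792589016825054, 74432043487667, 14481876563786, 80871783963683, 0, 23748246712834, 0, 0],
      ![0, 11156909439662, 0, 0, 17726409494312607, 47269480661581, 10592862505741, 45219230104933, 0, 13172416089446, 0, 0],
      ![0, 57262578732, 0, 0, 110967705131462, 313747924983, 56829058542, 225598544211, 0, 107208865722, 0, 0],
      ![0, 4643610762, 0, 0, 11398020283241, 25996155762, 12175977273, 22028917536, 0, 1234891950, 0, 0],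
      ![0, 233058724892, 0, 0, 157869251085058, 192468544933, 109227159388, 1008059748451, 0, 48530166715, 0, 0],
      ![0, 2076026656760, 0, 0, 2380659685716090, 4204024102203, 2130979381404, 9400096813051, 0, 154008756448, 0, 0],
      ![0, 92549370859, 0, 672465206529, 61023016279806, 86143710653, 43084095208, 602236632921, 0, 0, 0, 0],
      ![0, 18850943452358, 0, 0, 20972032523368484, 50422951714359, 12242595233378, 74131003774707, 0, 14907663922620, 0, 0],
      ![0, 16089705423, 0, 126648862253, 32629879674278, 82373297721, 36009378504, 96704095653, 0, 0, 0, 0],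
      ![0, 40019194828228, 0, 0, 51497379754865566, 132780845265439, 29228167029666, 156478762444857, 0, 39327695558188, 0, 0],
      ![0, 48758903037614, 0, 0, 68476146879140074, 181228628344399, 38323659133356, 191515652488573, 0, 54342032367250, 0, 0]],
    ![![0, 140755322631, 0, 1524231472981, 154500597197398, 271855133121, 134980006920, 1058875259277, 0, 0, 0, 0],
      ![0, 2465001638781, 0, 18752300096311, 1947072351824530, 2796961049883, 1672888156632, 15651882451359, 0, 0, 0, 0],
      ![0, 98440180047, 0, 533815530517, 67684550605630, 98283009825, 55951023744, 548603848485, 0, 0, 0, 0],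
      ![0, 4145552925, 0, 15813944599, 2165527376082, 2580599931, 1370414808, 21341409663, 0, 0, 0, 0],
      ![0, 8754916695, 0, 0, 5760135331303, 7505286588, 3353717283, 38461743003, 0, 1110204678, 0, 0],
      ![0, 12686883891, 0, 543277908409, 33842691136366, 76498899477, 30370784136, 222182583777, 0, 0, 0, 0],
      ![0, 21536094921, 0, 300766409243, 28882904205770, 59839313391, 22159217784, 180809823843, 0, 0, 0, 0],
      ![0, 8340748119, 0, 475484810117, 45153023895350, 119321931729, 43613803464, 176430746877, 0, 0, 0, 0],
      ![0, 570813444289, 0, 6346509115907, 578143331798522, 950425346871, 514035552184, 4290524598283, 0, 0, 0, 0],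
      ![0, 1584688322043, 0, 0, 1617163897488501, 2925209522943, 1000138568994, 6985300108779, 0, 650545393370, 0, 0],
      ![0, 211208515617, 0, 1720604958755, 177071967536570, 270596405079, 154137880248, 1373697937579, 0, 0, 0, 0],
      ![0, 6031746026625, 0, 41669800151107, 4565573007267706, 6742161056631, 3860386934712, 36682804138827, 0, 0, 0, 0]],
    ![![0, 275342413797, 0, 5284181673839, 777632254929698, 1972801609779, 572479481112, 2936874660951, 0, 0, 0, 0],
      ![0, 287253431377, 0, 9634196069811, 1102475247415962, 2684517883047, 875938873656, 4545918206907, 0, 0, 0, 0],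
      ![0, 475304084739, 0, 17871001901897, 1862985190883054, 4331159245413, 1617056450856, 8048151971937, 0, 0, 0, 0],
      ![0, 7095047751, 0, 577926352917, 46430073901526, 114647485953, 44226437640, 207949743309, 0, 0, 0, 0],
      ![0, 79361469, 0, 4204966135, 240588121746, 613383771, 222257112, 1506890847, 0, 0, 0, 0],
      ![0, 52970254381, 0, 210358756679, 127993023174898, 358354079083, 74618242776, 309403039407, 0, 0, 0, 0],
      ![0, 4289195735, 0, 56264355045, 10481953916182, 28679716065, 6534876040, 34367800621, 0, 0, 0, 0],
      ![244613195582, 555429981010, 0, 0, 673163358966818, 2465487755537, 0, 1816015855087, 0, 809862442490, 0, 0],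
      ![0, 212439463995, 0, 4783815469361, 684779819512670, 1722123896493, 502581730728, 2584650295689, 0, 0, 0, 0],
      ![0, 97317113025, 0, 1995175667971, 131479722944122, 310730226807, 81861020472, 969812806347, 0, 0, 0, 0],
      ![0, 1730081323311, 0, 50334230435789, 6143232096879206, 14903580516825, 4842678498504, 24834093564357, 0, 0, 0, 0],
      ![0, 509621067549, 0, 17297759967127, 1944582617988178, 4656615742779, 1601131041048, 8075881726143, 0, 0, 0, 0]],
    ![![0, 84165010725, 0, 6080057647, 93171454134178, 288315292083, 32297718936, 247294616919, 0, 0, 0, 0],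
      ![0, 17979549869806, 0, 0, 22628071199057404, 72735372046825, 6455590452370, 57290704529989, 0, 1280086799366, 0, 0],
      ![0, 20713072180430, 0, 0, 28926152089732110, 86404700926165, 9299265991156, 78903788814715, 0, 1130164252940, 0, 0],
      ![53002113782, 215917016842, 0, 0, 320499433254970, 1123025378573, 0, 800532371747, 0, 232966567346, 0, 0],
      ![0, 8193273186, 0, 0, 18603004110218, 51471658461, 8266895652, 39539391651, 0, 2766189288, 0, 0],
      ![380414344374, 1140359644490, 0, 0, 393376985105546, 2129700645285, 0, 1314949815819, 0, 358005048322, 0, 0],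
      ![44416596942, 185701361402, 0, 0, 151651909287714, 582766675977, 0, 365350175279, 0, 70836492002, 0, 0],
      ![11880927520, 50958307125, 0, 476359579975, 9349151015386, 54368722947, 0, 174542864111, 0, 0, 0, 0],
      ![0, 7425710008584, 0, 0, 8048800968832914, 26282031445255, 2435114457543, 20642964908452, 0, 21171020828, 0, 0],
      ![0, 123622455165, 0, 1605771396407, 379440030393746, 1108685020443, 228010167000, 924269869215, 0, 0, 0, 0],
      ![0, 13366825065, 0, 316808443, 16460459323658, 51619430863, 5360997752, 43091767235, 0, 0, 0, 0],
      ![0, 42686570691196, 0, 0, 55220209931190430, 172212928455827, 16058732030808, 146037433062011, 0, 3204506829788, 0, 0]],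
    ![![7848497184, 73678118151, 0, 88544001685, 41392473042046, 99452764917, 0, 130920767505, 0, 0, 0, 0],
      ![1576374552, 16485936981, 0, 16433293975, 6379268463922, 22637591559, 0, 14948211771, 0, 0, 0, 0],
      ![2118295944, 19886828175, 0, 74281471565, 7560739178198, 37712318589, 0, 24214458105, 0, 0, 0, 0],
      ![1308888857868, 3514321380627, 220011095406, 22333267693393, 0, 5042602985541, 0, 4627357854969, 0, 0, 0, 0],
      ![22863720, 47531781, 0, 60069359, 5695799106, 59246319, 0, 64509027, 0, 0, 0, 0],
      ![359817125934, 15228892868, 513012527639, 0, 577463182525121, 0, 0, 1703954315140, 0, 1304175041036, 0, 0],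
      ![213198658834, 96824872788, 16009297681, 0, 24803503983035, 0, 0, 0, 0, 19578220676, 55560652728, 0],
      ![0, 11285751, 0, 318217253, 1097435697526, 1652373905, 254307592, 1829976925, 0, 0, 0, 0],
      ![48134878176, 911476918671, 0, 7971780077, 470386259286230, 1085675215317, 0, 1098589332225, 0, 0, 0, 0],
      ![1050787098589, 315554115351, 0, 0, 91383247679743, 1438247062555, 0, 0, 726560832491, 1218198066179, 0, 0],
      ![142498546344, 2286284065263, 0, 2970510146381, 1028527072170038, 3445687762209, 0, 2471012646333, 0, 0, 0, 0],
      ![75711704838, 752723283972, 0, 1827118686394, 295673284671772, 1213841927529, 0, 836134906761, 0, 0, 0, 0]]]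

/-- The denominators that go with `reflWeight`. -/
def reflWeightDenom : Fin 8 → Fin 12 → ℕ :=
  ![![268478464254, 1556539055851, 3113078111702, 1942295104190, 56337753472, 27501100704, 338026520832, 1489103616, 268478464254, 338026520832, 1556539055851, 119733773527],
    ![3714577152, 169013260416, 338026520832, 89492821418, 1556539055851, 169013260416, 48289502976, 84506630208, 338026520832, 338026520832, 42253315104, 169013260416],
    ![30729683712, 112675506944, 10563328776, 112675506944, 56337753472, 239467547054, 24144751488, 3113078111702, 26002040064, 112675506944, 56337753472, 21126657552],
    ![3113078111702, 3113078111702, 1556539055851, 239467547054, 1556539055851, 119733773527, 3113078111702, 112675506944, 3113078111702, 24144751488, 3113078111702, 3113078111702],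
    ![48289502976, 338026520832, 10563328776, 10243227904, 1556539055851, 21126657552, 48289502976, 42253315104, 112675506944, 1556539055851, 16096500992, 338026520832],
    ![169013260416, 112675506944, 169013260416, 112675506944, 56337753472, 56337753472, 14084438368, 959886093616, 84506630208, 169013260416, 338026520832, 84506630208],
    ![30729683712, 3113078111702, 3113078111702, 959886093616, 3113078111702, 959886093616, 479943046808, 110220163592, 1556539055851, 338026520832, 1238192384, 3113078111702],
    ![47237212968, 4294292088, 4294292088, 20227471347656, 15745737656, 2731468295668, 1623087910528, 2560806976, 330660490776, 1876445694389, 330660490776, 82665122694]]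

theorem weight_spec : ∀ i k, 0 < weightDenom i k ∧
    (weightDenom i k : ℤ) • (-1 : ℤ) ^ (i.val + 1) •
        transvection ℤ ((companionMap ℤ)^[i.val + 1] (ray k)) =
      ∑ l, (weight i k l : ℤ) • ray l := by
  decide +kernel

theorem reflWeight_spec : ∀ i k, 0 < reflWeightDenom i k ∧
    (reflWeightDenom i k : ℤ) • (-1 : ℤ) ^ (i.val + 1) •
        transvection ℤ ((companionMap ℤ)^[i.val + 1] (reflection ℤ (ray k))) =
      ∑ l, (reflWeight i k l : ℤ) • ray l := by
  decide +kernel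

theorem direction_spec : (56337753472 : ℤ) • direction ℤ =
    ∑ l, ((![0, 19003083, 0, 24700449, 17981181246, 11552541, 286475112, 80446905, 0, 0, 0, 0] :
      Fin 12 → ℕ) l : ℤ) • ray l := by
  decide +kernel

theorem ray_alternating : ∀ (i : Fin 8) k,
    0 < (-1 : ℤ) ^ i.val * (companionMap ℤ)^[i.val + 1] (ray k) 0 ∧
    0 < (-1 : ℤ) ^ i.val * (companionMap ℤ)^[i.val + 1] (reflection ℤ (ray k)) 0 := by
  decide +kernel

section Maps

variable {K : Type} [CommRing K]

theorem reflection_reflection (v : Fin 6 → K) : reflection K (reflection K v) = v := by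
  ext i; fin_cases i <;> simp [reflection]

theorem companionMap_iterate_three (v : Fin 6 → K) :
    (companionMap K)^[3] v = ![-v 3, -v 4, -v 5, v 0 - v 3, v 1 - v 4, v 2 - v 5] := by
  ext i; fin_cases i <;> simp [companionMap]

theorem companionMap_iterate_nine (v : Fin 6 → K) : (companionMap K)^[9] v = v := by
  rw [show 9 = 3 * 3 from rfl, Function.iterate_mul]
  simp only [Function.iterate_succ_apply (companionMap K)^[3], Function.iterate_zero_apply,
    companionMap_iterate_three]
  ext i; fin_cases i <;> simp <;> ring

theorem companionMap_reflection_companionMap (v : Fin 6 → K) :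
    companionMap K (reflection K (companionMap K v)) = reflection K v := by
  ext i; fin_cases i <;> simp [companionMap, reflection]

theorem companionMap_iterate_reflection_iterate (n : ℕ) (v : Fin 6 → K) :
    (companionMap K)^[n] (reflection K ((companionMap K)^[n] v)) = reflection K v := by
  induction n generalizing v with
  | zero => rfl
  | succ n ih =>
    rw [Function.iterate_succ_apply, Function.iterate_succ_apply',
      companionMap_reflection_companionMap, ih]

theorem reflection_companionMap_iterate {m n : ℕ} (h : m + n = 9) (v : Fin 6 → K) :
    reflection K ((companionMap K)^[m] v) = (companionMap K)^[n] (reflection K v) := by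
  rw [← companionMap_iterate_reflection_iterate m v, ← Function.iterate_add_apply, add_comm n m, h,
    companionMap_iterate_nine]

theorem direction_zero : direction K 0 = 0 := rfl

theorem transvection_apply (v : Fin 6 → K) :
    transvection K v = v - v 0 • direction K := by
  ext i; fin_cases i <;> simp [transvection, direction, mul_comm, sub_eq_add_neg]

theorem transvection_iterate (n : ℕ) (v : Fin 6 → K) :
    (transvection K)^[n] v = v - (n * v 0) • direction K := by
  induction n with
  | zero => simp
  | succ n ih =>
    rw [Function.iterate_succ_apply', ih]
    rw [transvection_apply]
    simp [direction_zero, add_mul, add_smul, sub_sub]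

theorem transvection_reflection_transvection (v : Fin 6 → K) :
    transvection K (reflection K (transvection K v)) = reflection K v := by
  ext i; fin_cases i <;> simp [transvection, reflection] <;> ring

theorem transvection_iterate_reflection_iterate (n : ℕ) (v : Fin 6 → K) :
    (transvection K)^[n] (reflection K ((transvection K)^[n] v)) = reflection K v := by
  induction n generalizing v with
  | zero => rfl
  | succ n ih =>
    rw [Function.iterate_succ_apply, Function.iterate_succ_apply',
      transvection_reflection_transvection, ih]

end Maps

/-- Coordinatewise cast of an integer vector to a rational one. -/
def castVec (v : Fin 6 → ℤ) : Fin 6 → ℚ := fun i => v i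

theorem castVec_companionMap_iterate (n : ℕ) (v : Fin 6 → ℤ) :
    castVec ((companionMap ℤ)^[n] v) = (companionMap ℚ)^[n] (castVec v) :=
  Function.Semiconj.iterate_right
    (fun v => by ext i; fin_cases i <;> simp [castVec, companionMap]) n v

theorem castVec_transvection (v : Fin 6 → ℤ) :
    castVec (transvection ℤ v) = transvection ℚ (castVec v) := by
  ext i; fin_cases i <;> simp [castVec, transvection]

theorem castVec_reflection (v : Fin 6 → ℤ) :
    castVec (reflection ℤ v) = reflection ℚ (castVec v) := by
  ext i; fin_cases i <;> simp [castVec, reflection]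

theorem castVec_smul (a : ℤ) (v : Fin 6 → ℤ) : castVec (a • v) = (a : ℚ) • castVec v := by
  ext i; simp [castVec]

theorem castVec_sum (w : Fin 12 → ℕ) :
    castVec (∑ l, (w l : ℤ) • ray l) = ∑ l, (w l : ℚ) • castVec (ray l) := by
  ext i; simp [castVec]

/-- The polyhedral cone generated by the vectors `ray k`. -/
def cone : PointedCone ℚ (Fin 6 → ℚ) := PointedCone.hull ℚ (Set.range fun k => castVec (ray k))

theorem castVec_ray_mem_cone (k : Fin 12) : castVec (ray k) ∈ cone :=
  Submodule.subset_span (Set.mem_range_self k)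

theorem smul_mem_cone {a : ℚ} (ha : 0 ≤ a) {v : Fin 6 → ℚ} (hv : v ∈ cone) : a • v ∈ cone :=
  cone.smul_mem ha hv

theorem castVec_mem_cone {v : Fin 6 → ℤ} {d : ℕ} {w : Fin 12 → ℕ} (hd : 0 < d)
    (h : (d : ℤ) • v = ∑ l, (w l : ℤ) • ray l) : castVec v ∈ cone := by
  have hd' : (d : ℚ) ≠ 0 := by positivity
  have h' := congrArg castVec h
  rw [castVec_smul, castVec_sum, Int.cast_natCast] at h'
  rw [← inv_smul_smul₀ hd' (castVec v), h']
  exact smul_mem_cone (by positivity) (Submodule.sum_mem _ fun l _ =>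
    smul_mem_cone (by positivity) (castVec_ray_mem_cone l))

theorem direction_mem_cone : direction ℚ ∈ cone := by
  have h : castVec (direction ℤ) = direction ℚ := by
    ext i; fin_cases i <;> simp [castVec, direction]
  exact h ▸ castVec_mem_cone (d := 56337753472) (by norm_num) direction_spec

theorem transvection_mem_cone (i : Fin 8) {v : Fin 6 → ℚ} (hv : v ∈ cone) :
    (-1 : ℚ) ^ (i.val + 1) • transvection ℚ ((companionMap ℚ)^[i.val + 1] v) ∈ cone := by
  let f : Module.End ℚ (Fin 6 → ℚ) :=
    (-1 : ℚ) ^ (i.val + 1) • (transvection ℚ * companionMap ℚ ^ (i.val + 1))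
  have hf : ∀ v, f v = (-1 : ℚ) ^ (i.val + 1) •
      transvection ℚ ((companionMap ℚ)^[i.val + 1] v) := fun v => by
    simp only [f, LinearMap.smul_apply, Module.End.mul_apply, Module.End.pow_apply]
  have hle : cone ≤ cone.comap f := by
    refine Submodule.span_le.mpr ?_
    rintro _ ⟨k, rfl⟩
    change f (castVec (ray k)) ∈ cone
    have := castVec_mem_cone (weight_spec i k).1 (weight_spec i k).2
    rw [castVec_smul, castVec_transvection, castVec_companionMap_iterate] at this
    rw [hf]
    exact_mod_cast this
  exact hf v ▸ hle hv

theorem transvection_reflection_mem_cone (i : Fin 8) {v : Fin 6 → ℚ} (hv : v ∈ cone) :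
    (-1 : ℚ) ^ (i.val + 1) •
      transvection ℚ ((companionMap ℚ)^[i.val + 1] (reflection ℚ v)) ∈ cone := by
  let f : Module.End ℚ (Fin 6 → ℚ) :=
    (-1 : ℚ) ^ (i.val + 1) • (transvection ℚ * companionMap ℚ ^ (i.val + 1) * reflection ℚ)
  have hf : ∀ v, f v = (-1 : ℚ) ^ (i.val + 1) •
      transvection ℚ ((companionMap ℚ)^[i.val + 1] (reflection ℚ v)) := fun v => by
    simp only [f, LinearMap.smul_apply, Module.End.mul_apply, Module.End.pow_apply]
  have hle : cone ≤ cone.comap f := by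
    refine Submodule.span_le.mpr ?_
    rintro _ ⟨k, rfl⟩
    change f (castVec (ray k)) ∈ cone
    have := castVec_mem_cone (reflWeight_spec i k).1 (reflWeight_spec i k).2
    rw [castVec_smul, castVec_transvection, castVec_companionMap_iterate,
      castVec_reflection] at this
    rw [hf]
    exact_mod_cast this
  exact hf v ▸ hle hv

theorem cone_alternating {v : Fin 6 → ℚ} (hv : v ∈ cone) : v = 0 ∨ ∀ i : Fin 8,
    0 < (-1 : ℚ) ^ i.val * (companionMap ℚ)^[i.val + 1] v 0 ∧
    0 < (-1 : ℚ) ^ i.val * (companionMap ℚ)^[i.val + 1] (reflection ℚ v) 0 := by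
  simp only [← Module.End.pow_apply]
  induction hv using Submodule.span_induction with
  | mem x hx =>
    obtain ⟨k, rfl⟩ := hx
    refine Or.inr fun i => ?_
    obtain ⟨h₁, h₂⟩ := ray_alternating i k
    simp only [Module.End.pow_apply]
    rw [← castVec_reflection, ← castVec_companionMap_iterate, ← castVec_companionMap_iterate]
    simp only [castVec]
    exact ⟨by exact_mod_cast h₁, by exact_mod_cast h₂⟩
  | zero => exact Or.inl rfl
  | add x y _ _ hx hy =>
    rcases hx with rfl | hx
    · simpa using hy
    rcases hy with rfl | hy
    · simpa using Or.inr hx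
    refine Or.inr fun i => ?_
    simp only [map_add, Pi.add_apply, mul_add]
    exact ⟨add_pos (hx i).1 (hy i).1, add_pos (hx i).2 (hy i).2⟩
  | smul a x _ hx =>
    change (a : ℚ) • x = 0 ∨ ∀ i : Fin 8,
      0 < (-1 : ℚ) ^ i.val * (companionMap ℚ ^ (i.val + 1)) ((a : ℚ) • x) 0 ∧
      0 < (-1 : ℚ) ^ i.val * (companionMap ℚ ^ (i.val + 1)) (reflection ℚ ((a : ℚ) • x)) 0
    rcases hx with rfl | hx
    · exact Or.inl (smul_zero _)
    rcases a.2.eq_or_lt with ha | ha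
    · exact Or.inl (by rw [← ha, zero_smul])
    refine Or.inr fun i => ?_
    simp only [map_smul, Pi.smul_apply, smul_eq_mul, mul_left_comm _ (a : ℚ)]
    exact ⟨mul_pos ha (hx i).1, mul_pos ha (hx i).2⟩

theorem transvection_mem_and_pos (i : Fin 8) {u : Fin 6 → ℚ} (hu : u ∈ cone ∨ reflection ℚ u ∈ cone)
    (hu₀ : u ≠ 0) :
    (-1 : ℚ) ^ (i.val + 1) • transvection ℚ ((companionMap ℚ)^[i.val + 1] u) ∈ cone ∧
      0 < (-1 : ℚ) ^ i.val * (companionMap ℚ)^[i.val + 1] u 0 := by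
  rcases hu with hu | hu
  · exact ⟨transvection_mem_cone i hu, (((cone_alternating hu).resolve_left hu₀) i).1⟩
  · have hru : reflection ℚ u ≠ 0 := fun h => hu₀ (by
      rw [← reflection_reflection u, h, map_zero])
    have hmem := transvection_reflection_mem_cone i hu
    have hpos := (((cone_alternating hu).resolve_left hru) i).2
    rw [reflection_reflection] at hmem hpos
    exact ⟨hmem, hpos⟩

/-- The union of the cone with its images under `± 1` and `± reflection`, without the origin. -/
def pingSet : Set (Fin 6 → ℚ) :=
  {v | v ≠ 0 ∧ ∃ n : ℕ, (-1 : ℚ) ^ n • v ∈ cone ∨ reflection ℚ ((-1 : ℚ) ^ n • v) ∈ cone}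

theorem direction_mem_pingSet : direction ℚ ∈ pingSet := by
  refine ⟨fun h => ?_, 0, Or.inl (by simpa using direction_mem_cone)⟩
  have := congrFun h 1
  norm_num [direction] at this

theorem reflection_mem_pingSet {v : Fin 6 → ℚ} (hv : v ∈ pingSet) : reflection ℚ v ∈ pingSet := by
  obtain ⟨hv₀, n, hn⟩ := hv
  refine ⟨fun h => hv₀ (by rw [← reflection_reflection v, h, map_zero]), n, ?_⟩
  rw [← map_smul, reflection_reflection]
  exact hn.symm

theorem companionMap_iterate_smul (n : ℕ) (a : ℚ) (v : Fin 6 → ℚ) :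
    (companionMap ℚ)^[n] (a • v) = a • (companionMap ℚ)^[n] v := by
  rw [← Module.End.pow_apply, map_smul, Module.End.pow_apply]

theorem companionMap_iterate_apply_zero_ne_zero {v : Fin 6 → ℚ} (hv : v ∈ pingSet) (i : Fin 8) :
    (companionMap ℚ)^[i.val + 1] v 0 ≠ 0 := by
  obtain ⟨hv₀, n, hn⟩ := hv
  intro h
  have := (transvection_mem_and_pos i hn (smul_ne_zero (by simp) hv₀)).2
  rw [companionMap_iterate_smul, Pi.smul_apply, h] at this
  simp at this

theorem companionMap_iterate_direction_notMem (i : Fin 8) :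
    (companionMap ℚ)^[i.val + 1] (direction ℚ) ∉ pingSet := by
  intro h
  apply companionMap_iterate_apply_zero_ne_zero h i.rev
  rw [← Function.iterate_add_apply, show i.rev.val + 1 + (i.val + 1) = 9 by
    rw [Fin.val_rev]; lia, companionMap_iterate_nine]
  simp [direction]

theorem transvection_iterate_mem_pingSet (n : ℕ) (i : Fin 8) {v : Fin 6 → ℚ} (hv : v ∈ pingSet) :
    (transvection ℚ)^[n + 1] ((companionMap ℚ)^[i.val + 1] v) ∈ pingSet := by
  have hne := companionMap_iterate_apply_zero_ne_zero hv i
  obtain ⟨hv₀, m, hm⟩ := hv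
  refine ⟨fun h => hne ?_, i.val + 1 + m, Or.inl ?_⟩
  · have h0 := congrFun h 0
    rw [transvection_iterate] at h0
    simpa [direction] using h0
  · obtain ⟨hmem, hpos⟩ := transvection_mem_and_pos i hm (smul_ne_zero (by simp) hv₀)
    have hsum := cone.add_mem hmem
      (smul_mem_cone (mul_nonneg n.cast_nonneg hpos.le) direction_mem_cone)
    convert hsum using 1
    rw [companionMap_iterate_smul, transvection_iterate,
      ← Function.iterate_one (transvection ℚ), transvection_iterate]
    ext j
    simp only [Pi.smul_apply, Pi.sub_apply, Pi.add_apply, smul_eq_mul]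
    push_cast
    ring

section Action

variable {G : Type} [Group G] [MulAction G (Fin 6 → ℚ)] {β τ : G}

theorem pow_smul_eq_companionMap_iterate (hβ : ∀ v : Fin 6 → ℚ, β • v = companionMap ℚ v)
    (n : ℕ) (v : Fin 6 → ℚ) : β ^ n • v = (companionMap ℚ)^[n] v := by
  rw [← smul_iterate_apply, funext hβ]

theorem pow_smul_eq_transvection_iterate (hτ : ∀ v : Fin 6 → ℚ, τ • v = transvection ℚ v)
    (n : ℕ) (v : Fin 6 → ℚ) : τ ^ n • v = (transvection ℚ)^[n] v := by
  rw [← smul_iterate_apply, funext hτ]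

theorem inv_pow_smul_eq_reflection (hτ : ∀ v : Fin 6 → ℚ, τ • v = transvection ℚ v)
    (n : ℕ) (v : Fin 6 → ℚ) :
    (τ ^ n)⁻¹ • v = reflection ℚ ((transvection ℚ)^[n] (reflection ℚ v)) := by
  rw [inv_smul_eq_iff, pow_smul_eq_transvection_iterate hτ,
    transvection_iterate_reflection_iterate, reflection_reflection]

theorem pow_three_ne_one (hβ : ∀ v : Fin 6 → ℚ, β • v = companionMap ℚ v) : β ^ 3 ≠ 1 := by
  intro h
  apply companionMap_iterate_direction_notMem 2
  change (companionMap ℚ)^[3] _ ∈ _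
  rw [← pow_smul_eq_companionMap_iterate hβ, h, one_smul]
  exact direction_mem_pingSet

theorem not_isOfFinOrder (hτ : ∀ v : Fin 6 → ℚ, τ • v = transvection ℚ v) : ¬IsOfFinOrder τ := by
  rw [isOfFinOrder_iff_pow_eq_one]
  rintro ⟨n, hn, h⟩
  obtain ⟨k, rfl⟩ := Nat.exists_eq_add_one.mpr hn
  apply companionMap_iterate_direction_notMem 0
  have := transvection_iterate_mem_pingSet k 0 direction_mem_pingSet
  rwa [← pow_smul_eq_transvection_iterate hτ, h, one_smul] at this

theorem injective_of_smul_eq (hβ : ∀ v : Fin 6 → ℚ, β • v = companionMap ℚ v)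
    (hτ : ∀ v : Fin 6 → ℚ, τ • v = transvection ℚ v)
    (ψ : Monoid.Coprod (Multiplicative ℤ) (Multiplicative (ZMod 9)) →* G)
    (hψτ : ψ (Monoid.Coprod.inl (Multiplicative.ofAdd (1 : ℤ))) = τ)
    (hψβ : ψ (Monoid.Coprod.inr (Multiplicative.ofAdd (1 : ZMod 9))) = β) :
    Function.Injective ψ := by
  have hinl : ∀ h : Multiplicative ℤ, ψ (Monoid.Coprod.inl h) = τ ^ h.toAdd := fun h => by
    rw [← hψτ, ← map_zpow, ← map_zpow, ← ofAdd_zsmul, smul_eq_mul, mul_one, ofAdd_toAdd]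
  have hinr : ∀ p : Multiplicative (ZMod 9), p ≠ 1 → ∃ i : Fin 8, ∀ v : Fin 6 → ℚ,
      ψ (Monoid.Coprod.inr p) • v = (companionMap ℚ)^[i.val + 1] v := fun p hp => by
    have h0 : p.toAdd.val ≠ 0 := fun h => hp ((ZMod.val_eq_zero p.toAdd).mp h)
    have h9 : p.toAdd.val < 9 := ZMod.val_lt p.toAdd
    refine ⟨⟨p.toAdd.val - 1, by lia⟩, fun v => ?_⟩
    rw [show p.toAdd.val - 1 + 1 = p.toAdd.val by lia, ← pow_smul_eq_companionMap_iterate hβ,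
      ← hψβ, ← map_pow, ← map_pow, ← ofAdd_nsmul, nsmul_one, ZMod.natCast_zmod_val, ofAdd_toAdd]
  have : Nontrivial (Multiplicative (ZMod 9)) := inferInstanceAs (Nontrivial (Fin 9))
  refine coprod_injective_of_ping_pong ψ pingSet (direction ℚ) direction_mem_pingSet ?_ ?_
  · intro p hp
    obtain ⟨i, hi⟩ := hinr p hp
    rw [hi]
    exact companionMap_iterate_direction_notMem i
  · intro h hh p hp x hx
    obtain ⟨i, hi⟩ := hinr p hp
    rw [hi, hinl]
    obtain ⟨n, hn⟩ := Int.eq_nat_or_neg h.toAdd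
    have hn0 : n ≠ 0 := by
      rintro rfl
      exact hh (Multiplicative.toAdd.injective (by simpa using hn))
    obtain ⟨k, rfl⟩ := Nat.exists_eq_add_one_of_ne_zero hn0
    rcases hn with hn | hn
    · rw [hn, zpow_natCast, pow_smul_eq_transvection_iterate hτ]
      exact transvection_iterate_mem_pingSet k i hx
    · rw [hn, _root_.zpow_neg, zpow_natCast, inv_pow_smul_eq_reflection hτ,
        reflection_companionMap_iterate (n := i.rev.val + 1) (by rw [Fin.val_rev]; lia)]
      exact reflection_mem_pingSet
        (transvection_iterate_mem_pingSet k i.rev (reflection_mem_pingSet hx))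

end Action

/-- The action of invertible matrices on column vectors. -/
abbrev mulVecAction : MulAction (GL (Fin 6) ℚ) (Fin 6 → ℚ) where
  smul g v := (g : Matrix (Fin 6) (Fin 6) ℚ) *ᵥ v
  one_smul v := Matrix.one_mulVec v
  mul_smul _ _ v := (Matrix.mulVec_mulVec v _ _).symm

theorem companionMatrix_cyclotomic_mulVec (v : Fin 6 → ℚ) :
    companionMatrix 6 (X ^ 6 + X ^ 3 + 1) *ᵥ v = companionMap ℚ v := by
  ext i
  fin_cases i <;>
    simp [companionMatrix, companionMap, Matrix.mulVec, dotProduct, Fin.sum_univ_succ, coeff_X_pow,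
      coeff_one] <;> ring

theorem transvection_companionMatrix_mulVec (v : Fin 6 → ℚ) :
    transvection ℚ (companionMatrix 6 ((X - 1) ^ 6) *ᵥ v) = companionMap ℚ v := by
  have hcoeff : ∀ k, ((X - 1 : ℚ[X]) ^ 6).coeff k = (-1) ^ (6 - k) * Nat.choose 6 k := fun k => by
    
    rw [show (X - 1 : ℚ[X]) = X + C (-1) by simp [sub_eq_add_neg], coeff_X_add_C_pow]
  ext i
  fin_cases i <;>
    simp [companionMatrix, companionMap, transvection, Matrix.mulVec, dotProduct,
      Fin.sum_univ_succ, hcoeff, Nat.choose] <;> ring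

end A38

/-- The hypergeometric group of case A38 is isomorphic to `ℤ ∗ ℤ/9ℤ`, freely
generated by `T = B * A⁻¹` (of infinite order) and `B` (of order 9). -/
theorem thm_A38 (A B : GL (Fin 6) ℚ)
    (hA : (A : Matrix (Fin 6) (Fin 6) ℚ) = companionMatrix 6 ((X - 1) ^ 6))
    (hB : (B : Matrix (Fin 6) (Fin 6) ℚ) = companionMatrix 6 (X ^ 6 + X ^ 3 + 1)) :
    B ^ 9 = 1 ∧ orderOf B = 9 ∧ ¬ IsOfFinOrder (B * A⁻¹) ∧
      ∀ ψ : Monoid.Coprod (Multiplicative ℤ) (Multiplicative (ZMod 9)) →* GL (Fin 6) ℚ,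
        ψ (Monoid.Coprod.inl (Multiplicative.ofAdd (1 : ℤ))) = B * A⁻¹ →
        ψ (Monoid.Coprod.inr (Multiplicative.ofAdd (1 : ZMod 9))) = B →
        Function.Injective ψ := by
  let _ := A38.mulVecAction
  have hβ : ∀ v : Fin 6 → ℚ, B • v = A38.companionMap ℚ v := fun v => by
    change (B : Matrix (Fin 6) (Fin 6) ℚ) *ᵥ v = _
    rw [hB, A38.companionMatrix_cyclotomic_mulVec]
  have hτ : ∀ v : Fin 6 → ℚ, (B * A⁻¹) • v = A38.transvection ℚ v := fun v => by
    obtain ⟨u, rfl⟩ : ∃ u : Fin 6 → ℚ, A • u = v := ⟨A⁻¹ • v, smul_inv_smul A v⟩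
    rw [mul_smul, inv_smul_smul, hβ, ← A38.transvection_companionMatrix_mulVec, ← hA]
    rfl
  have hB9 : B ^ 9 = 1 := by
    refine Units.ext (Matrix.toLin'.injective (LinearMap.ext fun v => ?_))
    change B ^ 9 • v = (1 : GL (Fin 6) ℚ) • v
    rw [A38.pow_smul_eq_companionMap_iterate hβ, A38.companionMap_iterate_nine, one_smul]
  exact ⟨hB9, orderOf_eq_prime_pow (p := 3) (n := 1) (A38.pow_three_ne_one hβ) hB9,
    A38.not_isOfFinOrder hτ, A38.injective_of_smul_eq hβ hτ⟩
end

section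
/- Let A be the companion matrix of f(x) = (x−1)⁴(x²+x+1) and B the companion matrix of g(x) = (x+1)⁴(x²+1), regarded as elements of GL₆(ℚ), and set T = B·A⁻¹. Then T and B generate a free group of rank 2: the group homomorphism from the free group on two generators to GL₆(ℚ) sending the first generator to T and the second generator to B is injective. (This is the hypergeometric monodromy group of case C-2, with α = (0,0,0,0,1/3,2/3) and β = (1/2,1/2,1/2,1/2,1/4,3/4); in particular this group is isomorphic to ℤ ∗ ℤ.) -/
open Matrix Polynomial

/-- The matrix `-B`. -/
def matNegB : Matrix (Fin 6) (Fin 6) ℚ :=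
  !![0, 0, 0, 0, 0, 1;
     -1, 0, 0, 0, 0, 4;
     0, -1, 0, 0, 0, 7;
     0, 0, -1, 0, 0, 8;
     0, 0, 0, -1, 0, 7;
     0, 0, 0, 0, -1, 4]

/-- An involution conjugating `T` and `-B` to their inverses. -/
def matFlip : Matrix (Fin 6) (Fin 6) ℚ :=
  !![1, 0, 0, 0, 0, 0;
     4, 0, 0, 0, 0, -1;
     7, 0, 0, 0, -1, 0;
     8, 0, 0, -1, 0, 0;
     7, 0, -1, 0, 0, 0;
     4, -1, 0, 0, 0, 0]

/-- The vector spanning the image of `T - 1`. -/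
def vecT : Fin 6 → ℚ :=
  ![0, 7, 4, 10, 4, 7]

/-- The columns generate the ping-pong cone. -/
def coneGen : Matrix (Fin 6) (Fin 14) ℚ :=
  !![1, 3, 103, 1, 3, 87, 20, 41, 20, 72, 50, 121, 20, 103;
     3, 11, 373, 5, 13, 371, 74, 144, 86, 247, 220, 412, 74, 462;
     4, 16, 668, 5, 17, 627, 120, 213, 128, 360, 296, 600, 135, 591;
     4, 16, 668, 9, 27, 783, 120, 208, 178, 363, 448, 608, 157, 920;
     3, 13, 565, 6, 20, 586, 92, 167, 127, 296, 328, 484, 128, 669;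
     1, 5, 295, 6, 16, 330, 41, 72, 90, 121, 247, 188, 68, 540]

/-- Coefficients of the action of `-B` on the cone generators. -/
def coeffNegB : Matrix (Fin 14) (Fin 14) ℚ :=
  !![1, 2, 0, 89/64, 161353/63936, 990937/63936, 0, 0, 126965/15984, 0, 585635/15984, 5643/64,
       11553/8960, 57477/640;
     0, 1, 64, 0, 0, 0, 0, 0, 0, 0, 0, 25, 1327/280, 63/20;
     0, 0, 1, 1/64, 1649/63936, 641/63936, 0, 0, 1885/15984, 0, 4843/15984, 3/64, 489/8960,
       621/640;
     0, 0, 0, 9/32, 2633/7992, 465257/31968, 0, 0, 29717/15984, 0, 303263/63936, 0, 839/2240,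
       5307/320;
     0, 0, 0, 0, 0, 0, 0, 0, 0, 0, 0, 0, 0, 0;
     0, 0, 0, 1/32, 179/2664, 203/10656, 0, 0, 623/5328, 0, 17453/21312, 0, 79/2240, 707/320;
     0, 0, 0, 0, 76/333, 4864/333, 0, 0, 815/333, 0, 1556/333, 1, 76/35, 33/5;
     0, 0, 0, 0, 0, 0, 1, 0, 0, 0, 0, 0, 0, 0;
     0, 0, 0, 0, 4/999, 256/999, 0, 0, 446/999, 0, 485/999, 0, 0, 0;
     0, 0, 0, 0, 0, 0, 0, 1, 0, 0, 0, 0, 0, 0;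
     0, 0, 0, 0, 0, 0, 0, 0, 0, 0, 0, 0, 0, 0;
     0, 0, 0, 0, 0, 0, 0, 0, 0, 1, 0, 0, 0, 0;
     0, 0, 0, 0, 0, 0, 0, 0, 0, 0, 0, 0, 0, 0;
     0, 0, 0, 0, 0, 0, 0, 0, 0, 0, 0, 0, 0, 0]

/-- The matrix `-B * T`. -/
def matP : Matrix (Fin 6) (Fin 6) ℚ :=
  !![7, 0, 0, 0, 0, 1;
     27, 0, 0, 0, 0, 4;
     42, -1, 0, 0, 0, 7;
     52, 0, -1, 0, 0, 8;
     39, 0, 0, -1, 0, 7;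
     24, 0, 0, 0, -1, 4]

/-- Coefficients of the action of `-B * T` on the cone generators. -/
def coeffP : Matrix (Fin 14) (Fin 14) ℚ :=
  !![153/64, 395/64, 9167/64, 89/32, 214043/31968, 4363097/31968, 312649/8960, 38975/512,
       35720/999, 75225/512, 3394045/31968, 4103/16, 260753/8960, 149147/640;
     0, 1, 64, 0, 0, 0, 1651/280, 241/16, 0, 335/16, 0, 25, 1327/280, 63/20;
     1/64, 3/64, 167/64, 1/32, 2323/31968, 43777/31968, 3537/8960, 375/512, 430/999, 609/512,
       34661/31968, 31/16, 3289/8960, 1651/640;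
     41/32, 123/32, 4223/32, 25/16, 133409/31968, 2014345/15984, 62127/2240, 12217/256,
       439307/15984, 22417/256, 4399163/63936, 4961/32, 58239/2240, 47537/320;
     0, 0, 0, 0, 0, 0, 0, 29/8, 0, 17/8, 0, 0, 0, 0;
     1/32, 3/32, 103/32, 1/16, 1715/10656, 14587/5328, 1207/2240, 305/256, 3953/5328, 585/256,
       50753/21312, 121/32, 1479/2240, 1737/320;
     0, 0, 0, 0, 76/333, 4864/333, 23/35, 0, 815/333, 0, 1556/333, 1, 76/35, 33/5;
     0, 0, 0, 0, 0, 0, 0, 0, 0, 0, 0, 0, 0, 0;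
     0, 0, 0, 0, 4/999, 256/999, 0, 0, 446/999, 0, 485/999, 0, 0, 0;
     0, 0, 0, 0, 0, 0, 0, 0, 0, 0, 0, 0, 0, 0;
     0, 0, 0, 0, 0, 0, 0, 0, 0, 0, 0, 0, 0, 0;
     0, 0, 0, 0, 0, 0, 0, 0, 0, 0, 0, 0, 0, 0;
     0, 0, 0, 0, 0, 0, 0, 0, 0, 0, 0, 0, 0, 0;
     0, 0, 0, 0, 0, 0, 0, 0, 0, 0, 0, 0, 0, 0]

/-- The matrix `B * T⁻¹`. -/
def matQ : Matrix (Fin 6) (Fin 6) ℚ :=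
  !![7, 0, 0, 0, 0, -1;
     29, 0, 0, 0, 0, -4;
     42, 1, 0, 0, 0, -7;
     52, 0, 1, 0, 0, -8;
     39, 0, 0, 1, 0, -7;
     24, 0, 0, 0, 1, -4]

/-- Coefficients of the action of `B * T⁻¹` on the cone generators. -/
def coeffQ : Matrix (Fin 14) (Fin 14) ℚ :=
  !![25/64, 1249/3648, 17201/720, 0, 0, 0, 0, 0, 0, 54797/3648, 0, 98987/3648, 9035/86272, 0;
     0, 0, 37/30, 0, 0, 0, 9481/3337, 446909/105878, 0, 0, 0, 0, 3045/2696, 0;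
     1/64, 137/3648, 1/720, 0, 0, 0, 294/3337, 35519/105878, 0, 3157/3648, 0, 5539/3648,
       227/86272, 0;
     41/32, 3641/1824, 103/9, 1, 2, 0, 321537/106784, 65377981/3388096, 0, 212495/3648, 0,
       745699/7296, 0, 8419/128;
     0, 2/19, 103/15, 0, 1, 64, 25355/6674, 0, 0, 3/38, 0, 533/76, 6829/674, 117/4;
     1/32, 27/608, 0, 0, 0, 1, 21737/106784, 1278133/3388096, 0, 1437/1216, 0, 5913/2432,
       16/337, 11/128;
     0, 0, 0, 0, 0, 0, 0, 19273/52939, 0, 0, 0, 0, 0, 0;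
     0, 0, 0, 0, 0, 0, 0, 0, 0, 0, 0, 0, 0, 0;
     0, 16/57, 824/45, 0, 0, 0, 8223/3337, 286892/52939, 0, 335/57, 0, 401/57, 568/337, 1;
     0, 0, 0, 0, 0, 0, 0, 0, 0, 0, 0, 0, 0, 0;
     0, 0, 0, 0, 0, 0, 0, 0, 1, 0, 0, 0, 0, 0;
     0, 0, 0, 0, 0, 0, 0, 0, 0, 0, 0, 0, 0, 0;
     0, 0, 0, 0, 0, 0, 0, 0, 0, 0, 0, 0, 0, 0;
     0, 0, 0, 0, 0, 0, 0, 0, 0, 0, 1, 0, 0, 0]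

/-- The matrix `-B * T * matFlip`. -/
def matPFlip : Matrix (Fin 6) (Fin 6) ℚ :=
  !![11, -1, 0, 0, 0, 0;
     43, -4, 0, 0, 0, 0;
     66, -7, 0, 0, 0, 1;
     77, -8, 0, 0, 1, 0;
     59, -7, 0, 1, 0, 0;
     33, -4, 1, 0, 0, 0]

/-- Coefficients of the action of `-B * T * matFlip` on the cone generators. -/
def coeffPFlip : Matrix (Fin 14) (Fin 14) ℚ :=
  !![153/64, 23137/3648, 562327/3648, 89/64, 16634959/3999808, 478440179/3999808, 6923/192,
       2962553/47616, 25877035/1152576, 557879/3648, 39714577/576512, 119113/456,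
       58317523/1999904, 9167/64;
     0, 0, 0, 0, 0, 0, 0, 5281/496, 0, 0, 24923/18016, 0, 0, 0;
     1/64, 137/3648, 7343/3648, 1/64, 181991/3999808, 4855339/3999808, 67/192, 24961/47616,
       5608013/17288640, 3727/3648, 405977/576512, 785/456, 637035/1999904, 103/64;
     41/32, 3641/1824, 25031/1824, 9/32, 0, 0, 1069/96, 3811/372, 0, 202007/3648, 0,
       732589/7296, 0, 93/128;
     0, 2/19, 128/19, 0, 57382/62497, 3458641/62497, 7/2, 0, 2637691/270135, 3/38, 10515/563,
       533/76, 541166/62497, 117/4;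
     1/32, 27/608, 37/608, 1/32, 5763/62497, 97250/62497, 7/32, 0, 40007/90045, 1589/1216,
       6199/4504, 6103/2432, 17555/62497, 373/128;
     0, 0, 0, 0, 0, 0, 0, 13/62, 0, 0, 0, 0, 0, 0;
     0, 0, 0, 0, 0, 0, 0, 0, 0, 0, 0, 0, 0, 0;
     0, 16/57, 1024/57, 0, 40/62497, 4232/62497, 5/3, 1343/186, 0, 335/57, 0, 401/57,
       86184/62497, 1;
     0, 0, 0, 0, 0, 0, 0, 0, 25397/270135, 0, 0, 0, 0, 0;
     0, 0, 0, 0, 0, 0, 0, 0, 0, 0, 0, 0, 0, 0;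
     0, 0, 0, 0, 0, 0, 0, 0, 0, 0, 0, 0, 0, 0;
     0, 0, 0, 0, 1140/62497, 120612/62497, 0, 0, 46214/270135, 0, 975/2252, 0, 18861/62497, 0;
     0, 0, 0, 0, 0, 0, 0, 0, 0, 0, 0, 0, 0, 0]

/-- The matrix `B * T⁻¹ * matFlip`. -/
def matQFlip : Matrix (Fin 6) (Fin 6) ℚ :=
  !![3, 1, 0, 0, 0, 0;
     13, 4, 0, 0, 0, 0;
     18, 7, 0, 0, 0, -1;
     27, 8, 0, 0, -1, 0;
     19, 7, 0, -1, 0, 0;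
     15, 4, -1, 0, 0, 0]

/-- Coefficients of the action of `B * T⁻¹ * matFlip` on the cone generators. -/
def coeffQFlip : Matrix (Fin 14) (Fin 14) ℚ :=
  !![25/64, 11/64, 975/64, 89/64, 161353/63936, 990937/63936, 36149/8960, 1671/512,
       702665/63936, 4617/512, 2147735/63936, 1431/64, 17013/8960, 57477/640;
     0, 1, 64, 0, 0, 0, 1651/280, 241/16, 0, 335/16, 0, 25, 1327/280, 63/20;
     1/64, 3/64, 39/64, 1/64, 1649/63936, 641/63936, 1437/8960, 255/512, 2545/63936, 529/512,
       24367/63936, 111/64, 349/8960, 621/640;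
     41/32, 123/32, 4223/32, 73/32, 50585/7992, 4557161/31968, 55687/2240, 11757/256,
       2193791/63936, 23153/256, 6283277/63936, 10037/64, 2147/70, 1068/5;
     0, 0, 0, 0, 0, 0, 0, 29/8, 0, 17/8, 0, 0, 0, 0;
     1/32, 3/32, 103/32, 1/32, 179/2664, 21515/10656, 1487/2240, 325/256, 9485/21312, 553/256,
       23447/21312, 237/64, 16/35, 13/5;
     0, 0, 0, 0, 76/333, 4864/333, 23/35, 0, 815/333, 0, 1556/333, 1, 76/35, 33/5;
     0, 0, 0, 0, 0, 0, 0, 0, 0, 0, 0, 0, 0, 0;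
     0, 0, 0, 0, 4/999, 256/999, 0, 0, 446/999, 0, 485/999, 0, 0, 0;
     0, 0, 0, 0, 0, 0, 0, 0, 0, 0, 0, 0, 0, 0;
     0, 0, 0, 0, 0, 0, 0, 0, 0, 0, 0, 0, 0, 0;
     0, 0, 0, 0, 0, 0, 0, 0, 0, 0, 0, 0, 0, 0;
     0, 0, 0, 0, 0, 0, 0, 0, 0, 0, 0, 0, 0, 0;
     0, 0, 0, 0, 0, 0, 0, 0, 0, 0, 0, 0, 0, 0]

/-- Coefficients of `-B *ᵥ vecT` in the cone generators. -/
def coeffVecT : Fin 14 → ℚ :=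
  ![89/64, 0, 1/64, 41/32, 0, 1/32, 0, 0, 0, 0, 0, 0, 0, 0]

/-- The convex cone spanned by the columns of `coneGen`. -/
def pingCone : Set (Fin 6 → ℚ) :=
  {v | ∃ c : Fin 14 → ℚ, 0 ≤ c ∧ v = coneGen *ᵥ c}

lemma add_mem_pingCone {x y : Fin 6 → ℚ} (hx : x ∈ pingCone) (hy : y ∈ pingCone) :
    x + y ∈ pingCone := by
  obtain ⟨c, hc, rfl⟩ := hx
  obtain ⟨d, hd, rfl⟩ := hy
  exact ⟨c + d, add_nonneg hc hd, (mulVec_add _ _ _).symm⟩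

lemma smul_mem_pingCone {r : ℚ} (hr : 0 ≤ r) {x : Fin 6 → ℚ} (hx : x ∈ pingCone) :
    r • x ∈ pingCone := by
  obtain ⟨c, hc, rfl⟩ := hx
  exact ⟨r • c, smul_nonneg hr hc, (mulVec_smul _ _ _).symm⟩

lemma mulVec_mem_pingCone {M : Matrix (Fin 6) (Fin 6) ℚ} {C : Matrix (Fin 14) (Fin 14) ℚ}
    (h : M * coneGen = coneGen * C) (hC : ∀ p : Fin 14 × Fin 14, 0 ≤ C p.1 p.2) {x : Fin 6 → ℚ}
    (hx : x ∈ pingCone) : M *ᵥ x ∈ pingCone := by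
  obtain ⟨c, hc, rfl⟩ := hx
  refine ⟨C *ᵥ c, fun i => Finset.sum_nonneg fun j _ => mul_nonneg (hC (i, j)) (hc j), ?_⟩
  rw [mulVec_mulVec, mulVec_mulVec, h]

lemma pingCone_apply_zero_nonneg {x : Fin 6 → ℚ} (hx : x ∈ pingCone) : 0 ≤ x 0 := by
  obtain ⟨c, hc, rfl⟩ := hx
  have h : ∀ j, 0 < coneGen 0 j := by decide +kernel
  exact Finset.sum_nonneg fun j _ => mul_nonneg (h j).le (hc j)

lemma eq_zero_of_mem_pingCone {x : Fin 6 → ℚ} (hx : x ∈ pingCone) (h0 : x 0 = 0) : x = 0 := by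
  obtain ⟨c, hc, rfl⟩ := hx
  have h : ∀ j, 0 < coneGen 0 j := by decide +kernel
  have h0' : ∑ j, coneGen 0 j * c j = 0 := h0
  have hs := (Finset.sum_eq_zero_iff_of_nonneg
    fun j _ => mul_nonneg (h j).le (hc j)).1 h0'
  have : c = 0 := by
    ext j
    exact (mul_eq_zero.1 (hs j (Finset.mem_univ j))).resolve_left (h j).ne'
  rw [this, mulVec_zero]

lemma matNegB_mem {x : Fin 6 → ℚ} (hx : x ∈ pingCone) : matNegB *ᵥ x ∈ pingCone :=
  mulVec_mem_pingCone (C := coeffNegB) (by decide +kernel) (by decide +kernel) hx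

lemma matNegB_vecT_mem : matNegB *ᵥ vecT ∈ pingCone :=
  ⟨coeffVecT, (by decide +kernel : ∀ i, 0 ≤ coeffVecT i), by decide +kernel⟩

lemma matP_mem {x : Fin 6 → ℚ} (hx : x ∈ pingCone) :
    x 0 • (matNegB *ᵥ vecT) + matNegB *ᵥ x ∈ pingCone := by
  have h := mulVec_mem_pingCone (M := matP) (C := coeffP) (by decide +kernel)
    (by decide +kernel) hx
  convert h using 1
  ext i
  fin_cases i <;>
    simp [matNegB, vecT, matP, mulVec, dotProduct, Fin.sum_univ_succ] <;> ring

lemma matQ_mem {x : Fin 6 → ℚ} (hx : x ∈ pingCone) :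
    x 0 • (matNegB *ᵥ vecT) - matNegB *ᵥ x ∈ pingCone := by
  have h := mulVec_mem_pingCone (M := matQ) (C := coeffQ) (by decide +kernel)
    (by decide +kernel) hx
  convert h using 1
  ext i
  fin_cases i <;>
    simp [matNegB, vecT, matQ, mulVec, dotProduct, Fin.sum_univ_succ] <;> ring

lemma matPFlip_mem {x : Fin 6 → ℚ} (hx : x ∈ pingCone) :
    x 0 • (matNegB *ᵥ vecT) + matNegB *ᵥ matFlip *ᵥ x ∈ pingCone := by
  have h := mulVec_mem_pingCone (M := matPFlip) (C := coeffPFlip) (by decide +kernel)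
    (by decide +kernel) hx
  convert h using 1
  ext i
  fin_cases i <;>
    simp [matNegB, vecT, matPFlip, matFlip, mulVec, dotProduct, Fin.sum_univ_succ] <;> ring

lemma matQFlip_mem {x : Fin 6 → ℚ} (hx : x ∈ pingCone) :
    x 0 • (matNegB *ᵥ vecT) - matNegB *ᵥ matFlip *ᵥ x ∈ pingCone := by
  have h := mulVec_mem_pingCone (M := matQFlip) (C := coeffQFlip) (by decide +kernel)
    (by decide +kernel) hx
  convert h using 1
  ext i
  fin_cases i <;>
    simp [matNegB, vecT, matQFlip, matFlip, mulVec, dotProduct, Fin.sum_univ_succ] <;> ring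

lemma matFlip_matFlip (x : Fin 6 → ℚ) : matFlip *ᵥ matFlip *ᵥ x = x := by
  have h : matFlip * matFlip = 1 := by decide +kernel
  rw [mulVec_mulVec, h, one_mulVec]

lemma matFlip_apply_zero (x : Fin 6 → ℚ) : (matFlip *ᵥ x) 0 = x 0 := by
  simp [matFlip, mulVec, dotProduct, Fin.sum_univ_succ]

lemma matFlip_vecT : matFlip *ᵥ vecT = -vecT := by decide +kernel

lemma smul_add_mem_pingCone {r a : ℚ} (hr : 1 ≤ r) (ha : 0 ≤ a) {z : Fin 6 → ℚ}
    (h : a • (matNegB *ᵥ vecT) + z ∈ pingCone) :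
    (r * a) • (matNegB *ᵥ vecT) + z ∈ pingCone := by
  have := add_mem_pingCone h
    (smul_mem_pingCone (mul_nonneg (sub_nonneg.2 hr) ha) matNegB_vecT_mem)
  convert this using 1
  module

/-- The ping-pong set attached to the powers of `T`. -/
def pingSetT : Set (Fin 6 → ℚ) :=
  {v | v ≠ 0 ∧
    ((matNegB *ᵥ v ∈ pingCone ∧ -(matNegB *ᵥ matFlip *ᵥ v) ∈ pingCone) ∨
      (-(matNegB *ᵥ v) ∈ pingCone ∧ matNegB *ᵥ matFlip *ᵥ v ∈ pingCone))}

/-- The ping-pong set attached to the powers of `B`. -/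
def pingSetB : Set (Fin 6 → ℚ) :=
  {v | v ≠ 0 ∧ ((v ∈ pingCone ∨ -v ∈ pingCone) ∨
    (matFlip *ᵥ v ∈ pingCone ∨ -(matFlip *ᵥ v) ∈ pingCone))}

lemma vecT_mem_pingSetT : vecT ∈ pingSetT := by
  refine ⟨by decide +kernel, Or.inl ⟨matNegB_vecT_mem, ?_⟩⟩
  rw [matFlip_vecT, mulVec_neg, neg_neg]
  exact matNegB_vecT_mem

lemma vecT_notMem_pingSetB : vecT ∉ pingSetB := by
  rintro ⟨h0, h⟩
  rw [matFlip_vecT, neg_neg, or_comm (a := -vecT ∈ pingCone), or_self] at h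
  rcases h with h | h
  · exact h0 (eq_zero_of_mem_pingCone h rfl)
  · exact h0 (neg_eq_zero.1 (eq_zero_of_mem_pingCone h (by simp [vecT])))

lemma add_smul_vecT_mem_pingSetT {v : Fin 6 → ℚ} (hv : v ∈ pingSetB) {n : ℤ} (hn : n ≠ 0)
    (h0 : v + (n * v 0) • vecT ≠ 0) : v + (n * v 0) • vecT ∈ pingSetT := by
  refine ⟨h0, ?_⟩
  have e₁ : matNegB *ᵥ (v + (n * v 0) • vecT) =
      (n * v 0) • (matNegB *ᵥ vecT) + matNegB *ᵥ v := by
    rw [mulVec_add, mulVec_smul, add_comm]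
  have e₂ : matNegB *ᵥ matFlip *ᵥ (v + (n * v 0) • vecT) =
      -((n * v 0) • (matNegB *ᵥ vecT) + -(matNegB *ᵥ matFlip *ᵥ v)) := by
    rw [mulVec_add, mulVec_smul, matFlip_vecT, mulVec_add, mulVec_smul, mulVec_neg]
    module
  rw [e₁, e₂, neg_neg]
  obtain ⟨-, h⟩ := hv
  -- every case reduces to a vector `y` of the cone with `v = ± y` or `v = ± matFlip *ᵥ y`
  have key : ∀ y ∈ pingCone, ∀ r : ℚ, 1 ≤ r →
      (r * y 0) • (matNegB *ᵥ vecT) + matNegB *ᵥ y ∈ pingCone ∧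
      (r * y 0) • (matNegB *ᵥ vecT) + -(matNegB *ᵥ y) ∈ pingCone ∧
      (r * y 0) • (matNegB *ᵥ vecT) + matNegB *ᵥ matFlip *ᵥ y ∈ pingCone ∧
      (r * y 0) • (matNegB *ᵥ vecT) + -(matNegB *ᵥ matFlip *ᵥ y) ∈ pingCone := by
    intro y hy r hr
    have ha := pingCone_apply_zero_nonneg hy
    refine ⟨smul_add_mem_pingCone hr ha (matP_mem hy), smul_add_mem_pingCone hr ha ?_,
      smul_add_mem_pingCone hr ha (matPFlip_mem hy), smul_add_mem_pingCone hr ha ?_⟩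
    · rw [← sub_eq_add_neg]
      exact matQ_mem hy
    · rw [← sub_eq_add_neg]
      exact matQFlip_mem hy
  rcases lt_or_gt_of_ne hn with hn | hn
  · have hr : (1 : ℚ) ≤ -n := by exact_mod_cast (by lia : (1 : ℤ) ≤ -n)
    rcases h with (h | h) | (h | h) <;> obtain ⟨k₁, k₂, k₃, k₄⟩ := key _ h _ hr
    · refine Or.inr ⟨?_, ?_⟩
      · convert k₂ using 1; module
      · convert k₃ using 1; module
    · refine Or.inl ⟨?_, ?_⟩
      · convert k₂ using 1; simp only [Pi.neg_apply, mulVec_neg]; module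
      · convert k₃ using 1; simp only [Pi.neg_apply, mulVec_neg]; module
    · rw [matFlip_matFlip, matFlip_apply_zero] at *
      refine Or.inr ⟨?_, ?_⟩
      · convert k₄ using 1; module
      · convert k₁ using 1; module
    · rw [mulVec_neg, mulVec_neg, matFlip_matFlip, Pi.neg_apply, matFlip_apply_zero] at *
      refine Or.inl ⟨?_, ?_⟩
      · convert k₄ using 1; module
      · convert k₁ using 1; module
  · have hr : (1 : ℚ) ≤ n := by exact_mod_cast hn
    rcases h with (h | h) | (h | h) <;> obtain ⟨k₁, k₂, k₃, k₄⟩ := key _ h _ hr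
    · exact Or.inl ⟨k₁, k₄⟩
    · refine Or.inr ⟨?_, ?_⟩
      · convert k₁ using 1; simp only [Pi.neg_apply, mulVec_neg]; module
      · convert k₄ using 1; simp only [Pi.neg_apply, mulVec_neg]; module
    · rw [matFlip_matFlip, matFlip_apply_zero] at *
      exact Or.inl ⟨k₃, k₂⟩
    · rw [mulVec_neg, mulVec_neg, matFlip_matFlip, Pi.neg_apply, matFlip_apply_zero] at *
      refine Or.inr ⟨?_, ?_⟩
      · convert k₃ using 1; module
      · convert k₂ using 1; module

open Monoid CoprodI Pointwise in
lemma injective_freeGroup_lift_of_two_sets {G α : Type*} [Group G] [MulAction G α]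
    (a : Fin 2 → G) (X : Fin 2 → Set α)
    (hX : Pairwise fun i j => ∀ n : ℤ, n ≠ 0 → ∀ x ∈ X j, a i ^ n • x ∈ X i)
    (hne : ¬ X 0 ⊆ X 1) : Function.Injective (FreeGroup.lift a) := by
  let H : Fin 2 → Type := fun _ => FreeGroup Unit
  let f : ∀ i, H i →* G := fun i => FreeGroup.lift fun _ => a i
  have hlift : FreeGroup.lift a =
      (CoprodI.lift f).comp (@freeGroupEquivCoprodI (Fin 2)).toMonoidHom := by
    ext i
    simp only [FreeGroup.lift_apply_of, MonoidHom.comp_apply, MulEquiv.coe_toMonoidHom,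
      freeGroupEquivCoprodI_apply, CoprodI.lift_of]
    exact FreeGroup.lift_apply_of.symm
  have hpp : Pairwise fun i j => ∀ h : H i, h ≠ 1 → f i h • X j ⊆ X i := by
    intro i j hij
    refine FreeGroup.freeGroupUnitEquivInt.forall_congr_left.mpr ?_
    intro n hn
    change FreeGroup.lift (fun _ => a i) (FreeGroup.of () ^ n) • X j ⊆ X i
    rw [map_zpow, FreeGroup.lift_apply_of]
    rintro _ ⟨x, hx, rfl⟩
    refine hX hij n ?_ x hx
    rintro rfl
    exact hn (zpow_zero _)
  have hsame : ∀ w : NeWord H 1 1, CoprodI.lift f w.prod ≠ 1 := by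
    intro w h
    have := lift_word_ping_pong f X hpp w (k := 0) (by decide)
    rw [h, one_smul] at this
    exact hne this
  have hcard : 3 ≤ Cardinal.mk (FreeGroup Unit) := by
    rw [Cardinal.mk_congr FreeGroup.freeGroupUnitEquivInt, Cardinal.mk_denumerable]
    exact_mod_cast (Cardinal.natCast_lt_aleph0 (n := 3)).le
  have hdiff : ∀ w : NeWord H 1 0, CoprodI.lift f w.prod ≠ 1 := by
    intro w h
    obtain ⟨x, hx1, hx⟩ := Cardinal.exists_ne_ne_of_three_le hcard 1 w.head⁻¹
    have hx' : x * w.head ≠ 1 := by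
      rw [← div_inv_eq_mul]
      exact div_ne_one_of_ne hx
    refine hsame (NeWord.append (NeWord.mulHead w x hx') (by decide)
      (NeWord.singleton x⁻¹ (inv_ne_one.mpr hx1))) ?_
    simp [h]
  have hall : ∀ {i j} (w : NeWord H i j), CoprodI.lift f w.prod ≠ 1 := by
    intro i j w h
    fin_cases i <;> fin_cases j
    · have hx : (FreeGroup.of () : H 1) ≠ 1 := FreeGroup.of_ne_one _
      refine hsame (NeWord.append (NeWord.append (NeWord.singleton _ hx) (by decide) w) (by decide)
        (NeWord.singleton _ (inv_ne_one.mpr hx))) ?_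
      simp_all
    · refine hdiff w.inv ?_
      simp_all
    · exact hdiff w h
    · exact hsame w h
  rw [hlift, MonoidHom.coe_comp]
  refine Function.Injective.comp ?_ (MulEquiv.injective freeGroupEquivCoprodI)
  classical
  refine (injective_iff_map_eq_one (CoprodI.lift f)).mpr ?_
  intro g hg
  obtain ⟨w, rfl⟩ := CoprodI.Word.equiv.symm.surjective g
  by_contra hne'
  have hw : w ≠ CoprodI.Word.empty := by
    rintro rfl
    exact hne' CoprodI.Word.prod_empty
  obtain ⟨i, j, w', rfl⟩ := NeWord.of_word w hw
  exact hall w' hg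

lemma zpow_mulVec_of_transvection {T : GL (Fin 6) ℚ}
    (hT : ∀ v, T.1 *ᵥ v = v + v 0 • vecT) (n : ℤ) (v : Fin 6 → ℚ) :
    (T ^ n).1 *ᵥ v = v + (n * v 0) • vecT := by
  have h0 : vecT 0 = 0 := rfl
  have hinv : ∀ v, (T⁻¹).1 *ᵥ v = v - v 0 • vecT := by
    intro v
    have h : v = T.1 *ᵥ (v - v 0 • vecT) := by
      rw [hT]
      simp [h0]
    conv_lhs => rw [h]
    rw [mulVec_mulVec, ← Units.val_mul, inv_mul_cancel, Units.val_one, one_mulVec]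
  induction n generalizing v with
  | zero => simp
  | succ n ih =>
    rw [_root_.zpow_add_one, Units.val_mul, ← mulVec_mulVec, hT, ih]
    simp [h0]
    module
  | pred n ih =>
    rw [_root_.zpow_sub_one, Units.val_mul, ← mulVec_mulVec, hinv, ih]
    simp [h0]
    module

lemma pow_succ_mulVec_mem {B : GL (Fin 6) ℚ} (hB : B.1 = -matNegB) (n : ℕ) {v : Fin 6 → ℚ}
    (hv : matNegB *ᵥ v ∈ pingCone ∨ -(matNegB *ᵥ v) ∈ pingCone) :
    (B ^ (n + 1)).1 *ᵥ v ∈ pingCone ∨ -((B ^ (n + 1)).1 *ᵥ v) ∈ pingCone := by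
  induction n with
  | zero =>
    rw [zero_add, pow_one, hB, neg_mulVec, neg_neg]
    exact hv.symm
  | succ n ih =>
    rw [pow_succ', Units.val_mul, ← mulVec_mulVec, hB, neg_mulVec, neg_neg]
    rcases ih with h | h
    · exact Or.inr (matNegB_mem h)
    · left
      rw [← mulVec_neg]
      exact matNegB_mem h

lemma zpow_mulVec_mem_pingSetB {B : GL (Fin 6) ℚ} (hB : B.1 = -matNegB) {n : ℤ} (hn : n ≠ 0)
    {v : Fin 6 → ℚ} (hv : v ∈ pingSetT) (h0 : (B ^ n).1 *ᵥ v ≠ 0) :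
    (B ^ n).1 *ᵥ v ∈ pingSetB := by
  refine ⟨h0, ?_⟩
  obtain ⟨-, hv⟩ := hv
  obtain ⟨n, rfl | rfl⟩ := n.eq_nat_or_neg
  · left
    obtain ⟨m, rfl⟩ := Nat.exists_eq_succ_of_ne_zero (n := n) (by simpa using hn)
    rw [zpow_natCast]
    exact pow_succ_mulVec_mem hB m (hv.imp And.left And.left)
  · right
    obtain ⟨m, rfl⟩ := Nat.exists_eq_succ_of_ne_zero (n := n) (by simpa using hn)
    have hE : matFlip * matFlip = 1 := by decide +kernel
    have hEB : B.1 * (matFlip * B.1) = matFlip := by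
      rw [hB]
      decide +kernel
    let E : GL (Fin 6) ℚ := ⟨matFlip, matFlip, hE, hE⟩
    have hconj : E * B⁻¹ * E⁻¹ = B := by
      have hBEB : B * (E * B) = E := Units.ext hEB
      have hEE : E⁻¹ = E := Units.ext rfl
      rw [hEE, mul_assoc, ← eq_inv_mul_iff_mul_eq, hEE, inv_mul_eq_iff_eq_mul]
      exact hBEB.symm
    have hpow : E * B ^ (-((m.succ : ℕ) : ℤ)) = B ^ (m + 1) * E := by
      rw [_root_.zpow_neg, zpow_natCast, ← inv_pow]
      nth_rewrite 2 [← hconj]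
      rw [conj_pow, inv_mul_cancel_right]
    have hpow' : matFlip *ᵥ (B ^ (-((m.succ : ℕ) : ℤ))).1 *ᵥ v =
        (B ^ (m + 1)).1 *ᵥ matFlip *ᵥ v := by
      have := congrArg Units.val hpow
      rw [Units.val_mul, Units.val_mul] at this
      rw [mulVec_mulVec, mulVec_mulVec]
      exact congrArg (· *ᵥ v) this
    rw [hpow']
    exact pow_succ_mulVec_mem hB m (hv.symm.imp And.right And.right)

lemma companionMatrix_g :
    companionMatrix 6 ((X + 1) ^ 4 * (X ^ 2 + 1) : ℚ[X]) = -matNegB := by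
  have h : ((X + 1) ^ 4 * (X ^ 2 + 1) : ℚ[X]) =
      X ^ 6 + C 4 * X ^ 5 + C 7 * X ^ 4 + C 8 * X ^ 3 + C 7 * X ^ 2 + C 4 * X + C 1 := by
    simp only [map_ofNat, map_one]
    ring
  rw [h]
  ext i j
  fin_cases i <;> fin_cases j <;>
    simp [companionMatrix, matNegB, coeff_X, coeff_one, coeff_X_pow]

lemma companionMatrix_f :
    companionMatrix 6 ((X - 1) ^ 4 * (X ^ 2 + X + 1) : ℚ[X]) =
      !![0, 0, 0, 0, 0, -1; 1, 0, 0, 0, 0, 3; 0, 1, 0, 0, 0, -3; 0, 0, 1, 0, 0, 2;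
        0, 0, 0, 1, 0, -3; 0, 0, 0, 0, 1, 3] := by
  have h : ((X - 1) ^ 4 * (X ^ 2 + X + 1) : ℚ[X]) =
      X ^ 6 + C (-3) * X ^ 5 + C 3 * X ^ 4 + C (-2) * X ^ 3 + C 3 * X ^ 2 + C (-3) * X + C 1 := by
    simp only [map_neg, map_ofNat, map_one]
    ring
  rw [h]
  ext i j
  fin_cases i <;> fin_cases j <;>
    simp [companionMatrix, coeff_X, coeff_one, coeff_X_pow]

lemma mul_inv_mulVec {A B : GL (Fin 6) ℚ}
    (hA : A.1 = companionMatrix 6 ((X - 1) ^ 4 * (X ^ 2 + X + 1)))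
    (hB : B.1 = -matNegB) (v : Fin 6 → ℚ) : (B * A⁻¹).1 *ᵥ v = v + v 0 • vecT := by
  let t : Matrix (Fin 6) (Fin 6) ℚ := 1 + vecMulVec vecT (Pi.single 0 1)
  have ht : t * A.1 = B.1 := by
    rw [hA, hB, companionMatrix_f]
    decide +kernel
  have hv : (B * A⁻¹).1 = t := by
    rw [Units.val_mul, ← ht, mul_assoc, ← Units.val_mul, mul_inv_cancel, Units.val_one, mul_one]
  rw [hv, add_mulVec, one_mulVec, vecMulVec_mulVec]
  simp

/-- The hypergeometric group of case C2 is free of rank 2 on `T = B * A⁻¹` and `B`. -/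
theorem thm_C2 (A B : GL (Fin 6) ℚ)
    (hA : (A : Matrix (Fin 6) (Fin 6) ℚ) = companionMatrix 6 ((X - 1) ^ 4 * (X ^ 2 + X + 1)))
    (hB : (B : Matrix (Fin 6) (Fin 6) ℚ) = companionMatrix 6 ((X + 1) ^ 4 * (X ^ 2 + 1))) :
    Function.Injective (FreeGroup.lift ![B * A⁻¹, B] : FreeGroup (Fin 2) →* GL (Fin 6) ℚ) := by
  have hB' : B.1 = -matNegB := hB.trans companionMatrix_g
  let _ : MulAction (GL (Fin 6) ℚ) (Fin 6 → ℚ) :=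
    { smul := fun g v => g.1 *ᵥ v
      one_smul := one_mulVec
      mul_smul := fun g h v => (mulVec_mulVec v g.1 h.1).symm }
  have hne : ∀ (g : GL (Fin 6) ℚ) {v : Fin 6 → ℚ}, v ≠ 0 → g.1 *ᵥ v ≠ 0 := by
    intro g v hv h
    refine hv ?_
    rw [← one_mulVec v, ← Units.val_one, ← inv_mul_cancel g, Units.val_mul, ← mulVec_mulVec, h,
      mulVec_zero]
  refine injective_freeGroup_lift_of_two_sets _ ![pingSetT, pingSetB] ?_
    fun h => vecT_notMem_pingSetB (h vecT_mem_pingSetT)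
  intro i j hij n hn v hv
  fin_cases i <;> fin_cases j <;> first | exact absurd rfl hij | skip
  · change ((B * A⁻¹) ^ n).1 *ᵥ v ∈ pingSetT
    have hv' : v ∈ pingSetB := hv
    have h0 := hne ((B * A⁻¹) ^ n) hv'.1
    rw [zpow_mulVec_of_transvection (mul_inv_mulVec hA hB')] at h0 ⊢
    exact add_smul_vecT_mem_pingSetT hv' hn h0
  · have hv' : v ∈ pingSetT := hv
    exact zpow_mulVec_mem_pingSetB hB' hn hv' (hne (B ^ n) hv'.1)
end
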